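/- arXiv:2206.00331 — 2 statements merged into one kernel-verified Lean document; each statement's English description precedes it below -/
import Mathlib

section
/- Let (E, L) and (F, M) be Euclidean lattices, and suppose there is a chain of rational subspaces 0 = F₀ ⊊ F₁ ⊊ ⋯ ⊊ F_t = F of (F, M) such that, writing Qᵢ for the successive quotient (the Euclidean lattice obtained as the image of Fᵢ ∩ M under the orthogonal projection of Fᵢ onto the orthogonal complement of F_{i−1} inside Fᵢ): (i) H_min of the tensor product of (E, L) with Qᵢ equals H_min(E, L)·H_min(Qᵢ) for all 1 ≤ i ≤ t, and (ii) H_min(Qᵢ) ≤ H_min(Q_{i+1}) for all 1 ≤ i ≤ t−1. Then H_min of the tensor product of (E, L) and (F, M) equals H_min(E, L)·H_min(F, M). -/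
open Module

noncomputable section

namespace EucLat

variable {E : Type*} [NormedAddCommGroup E] [InnerProductSpace ℝ E]

/-- The covolume of a `ℤ`-submodule of a real inner product space: the square root of the
Gram determinant of a `ℤ`-basis (junk value `0` if no finite basis exists). -/
def covol (L : Submodule ℤ E) : ℝ :=
  @dite _ (∃ n : ℕ, Nonempty (Basis (Fin n) ℤ L)) (Classical.propDecidable _)
    (fun h => Real.sqrt (Matrix.det (Matrix.of fun i j =>
      (inner ℝ ((h.choose_spec.some i : L) : E) ((h.choose_spec.some j : L) : E) : ℝ))))
    (fun _ => 0)

/-- The reduced height `covol(L)^(1/dim E)` of a full lattice. -/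
def redH (L : Submodule ℤ E) : ℝ := covol L ^ ((finrank ℝ E : ℝ)⁻¹)

/-- The lattice `L ∩ F` induced on a subspace `F`. -/
def latIn (L : Submodule ℤ E) (F : Submodule ℝ E) : Submodule ℤ F :=
  L.comap (F.subtype.restrictScalars ℤ)

/-- The reduced height of a subspace: `covol(F ∩ L)^(1/dim F)`. -/
def Hr (L : Submodule ℤ E) (F : Submodule ℝ E) : ℝ := redH (latIn L F)

/-- A subspace is rational if it is spanned by its intersection with the lattice. -/
def IsRational (L : Submodule ℤ E) (F : Submodule ℝ E) : Prop :=
  Submodule.span ℝ ((L : Set E) ∩ (F : Set E)) = F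

/-- `(E, L)` is a Euclidean lattice: `L` is discrete and spans `E` over `ℝ`. -/
def IsLat (L : Submodule ℤ E) : Prop :=
  DiscreteTopology L ∧ Submodule.span ℝ (L : Set E) = ⊤

/-- Minimal reduced height: infimum of reduced heights of nonzero rational subspaces. -/
def Hmin (L : Submodule ℤ E) : ℝ :=
  sInf {h : ℝ | ∃ F : Submodule ℝ E, F ≠ ⊥ ∧ IsRational L F ∧ h = Hr L F}

/-- Semistability of a Euclidean lattice. -/
def Semistable (L : Submodule ℤ E) : Prop :=
  ∀ F : Submodule ℝ E, F ≠ ⊥ → IsRational L F → redH L ≤ Hr L F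

/-- Stability of a Euclidean lattice. -/
def Stable (L : Submodule ℤ E) : Prop :=
  Semistable L ∧ ∀ F : Submodule ℝ E, F ≠ ⊥ → F ≠ ⊤ → IsRational L F → redH L < Hr L F

/-- The quotient lattice of `(E, L)` by a subspace `F`: the image of `L` under the
orthogonal projection of `E` onto `Fᗮ`. -/
def quotLat [FiniteDimensional ℝ E] (L : Submodule ℤ E) (F : Submodule ℝ E) :
    Submodule ℤ Fᗮ :=
  L.map ((Submodule.orthogonalProjectionOnto Fᗮ : E →ₗ[ℝ] Fᗮ).restrictScalars ℤ)

/-- For subspaces `F ≤ F'`, the successive quotient lattice: the image of `F' ∩ L` under the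
orthogonal projection of `F'` onto the orthogonal complement of `F` inside `F'`. -/
def succQuot [FiniteDimensional ℝ E] (L : Submodule ℤ E) (F F' : Submodule ℝ E) :
    Submodule ℤ ((F.comap F'.subtype)ᗮ) :=
  quotLat (latIn L F') (F.comap F'.subtype)

/-- A GS-flag of `(E, L)`. -/
def IsGSFlag [FiniteDimensional ℝ E] (L : Submodule ℤ E) {ℓ : ℕ}
    (C : Fin (ℓ + 1) → Submodule ℝ E) : Prop :=
  C 0 = ⊥ ∧ C (Fin.last ℓ) = ⊤ ∧
  (∀ i : Fin ℓ, C i.castSucc < C i.succ) ∧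
  (∀ i, IsRational L (C i)) ∧
  (∀ i : Fin ℓ, Semistable (succQuot L (C i.castSucc) (C i.succ))) ∧
  (∀ i j : Fin ℓ, i < j →
    redH (succQuot L (C i.castSucc) (C i.succ)) < redH (succQuot L (C j.castSucc) (C j.succ)))

/-- The dual lattice `L* = {y : ⟪x, y⟫ ∈ ℤ for all x ∈ L}`. -/
def dualLat (L : Submodule ℤ E) : Submodule ℤ E where
  carrier := {y | ∀ x ∈ L, ∃ n : ℤ, (inner ℝ x y : ℝ) = n}
  zero_mem' := fun x _ => ⟨0, by simp⟩
  add_mem' := by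
    intro a b ha hb x hx
    obtain ⟨m, hm⟩ := ha x hx
    obtain ⟨n, hn⟩ := hb x hx
    exact ⟨m + n, by rw [inner_add_right, hm, hn]; push_cast; ring⟩
  smul_mem' := by
    intro z y hy x hx
    obtain ⟨n, hn⟩ := hy x hx
    refine ⟨z * n, ?_⟩
    rw [← Int.cast_smul_eq_zsmul ℝ, real_inner_smul_right, hn]
    push_cast; ring

/-- `(E, L)` is isodual via the similarity `τ`. -/
def IsIsodual (L : Submodule ℤ E) (τ : E →ₗ[ℝ] E) : Prop :=
  (∃ α : ℝ, 0 < α ∧ ∀ x y : E, (inner ℝ (τ x) (τ y) : ℝ) = α * inner ℝ x y) ∧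
  L.map (τ.restrictScalars ℤ) = dualLat L

/-- The bilinear form `b_τ(x, y) = ⟪τ x, y⟫` associated with an isoduality. -/
def bform (τ : E →ₗ[ℝ] E) (x y : E) : ℝ := inner ℝ (τ x) y

/-- `b` has signature `s`: there is a `b`-orthogonal basis with `p - q = s`. -/
def HasSignature (b : E → E → ℝ) (s : ℤ) : Prop :=
  ∃ (n : ℕ) (v : Basis (Fin n) ℝ E),
    (∀ i j, i ≠ j → b (v i) (v j) = 0) ∧
    s = ((Finset.univ.filter fun i => 0 < b (v i) (v i)).card : ℤ) -
        ((Finset.univ.filter fun i => b (v i) (v i) < 0).card : ℤ)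

/-- The destabilizing subspace of `(E, L)`. -/
def IsDestabilizing (L : Submodule ℤ E) (F : Submodule ℝ E) : Prop :=
  F ≠ ⊥ ∧ IsRational L F ∧ Hr L F = Hmin L ∧
  ∀ F' : Submodule ℝ E, F' ≠ ⊥ → IsRational L F' → Hr L F' = Hmin L → F' ≤ F

/-- `(G, t)` is a realization of the tensor product of the inner product spaces `E` and `F`:
`t` induces a linear isomorphism `E ⊗ F ≃ G` and
`⟪t x y, t x' y'⟫ = ⟪x, x'⟫ * ⟪y, y'⟫` on pure tensors. -/
def IsTensor {F G : Type*} [NormedAddCommGroup F] [InnerProductSpace ℝ F]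
    [NormedAddCommGroup G] [InnerProductSpace ℝ G] (t : E →ₗ[ℝ] F →ₗ[ℝ] G) : Prop :=
  Function.Bijective (TensorProduct.lift t) ∧
  ∀ (x x' : E) (y y' : F),
    (inner ℝ (t x y) (t x' y') : ℝ) = (inner ℝ x x' : ℝ) * (inner ℝ y y' : ℝ)

/-- The tensor product lattice `L·M`: the additive subgroup generated by pure tensors. -/
def tensorLat {F G : Type*} [NormedAddCommGroup F] [InnerProductSpace ℝ F]
    [NormedAddCommGroup G] [InnerProductSpace ℝ G] (t : E →ₗ[ℝ] F →ₗ[ℝ] G)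
    (L : Submodule ℤ E) (M : Submodule ℤ F) : Submodule ℤ G :=
  Submodule.span ℤ (Set.image2 (fun x y => t x y) (L : Set E) (M : Set F))

/-- `g` is an automorphism of the Euclidean lattice `(E, L)`. -/
def IsAut (L : Submodule ℤ E) (g : E ≃ₗ[ℝ] E) : Prop :=
  (∀ x, x ∈ L ↔ g x ∈ L) ∧ ∀ x y : E, (inner ℝ (g x) (g y) : ℝ) = inner ℝ x y

/-- The direct product lattice `L × L'` inside `WithLp 2 (E × E')`. -/
def prodLat {E' : Type*} [NormedAddCommGroup E'] [InnerProductSpace ℝ E']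
    (L : Submodule ℤ E) (L' : Submodule ℤ E') : Submodule ℤ (WithLp 2 (E × E')) :=
  (L.prod L').comap (((WithLp.linearEquiv 2 ℝ (E × E')).restrictScalars ℤ) : WithLp 2 (E × E') →ₗ[ℤ] E × E')


section grdef

/-- Gram determinant of a finite family. -/
def gr {E : Type*} [NormedAddCommGroup E] [InnerProductSpace ℝ E] {ι : Type*} [Fintype ι]
    [DecidableEq ι] (v : ι → E) : ℝ := (Matrix.gram ℝ v).det

end grdef

section gramsec
variable {E : Type*} [NormedAddCommGroup E] [InnerProductSpace ℝ E]
variable {E' : Type*} [NormedAddCommGroup E'] [InnerProductSpace ℝ E']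
variable {ι κ : Type*} [Fintype ι] [DecidableEq ι] [Fintype κ] [DecidableEq κ]

theorem gr_nonneg (v : ι → E) : 0 ≤ gr v := (Matrix.posSemidef_gram ℝ v).det_nonneg

theorem gr_pos {v : ι → E} (h : LinearIndependent ℝ v) : 0 < gr v :=
  lt_of_le_of_ne (gr_nonneg v) (Ne.symm (Matrix.det_gram_ne_zero_iff_linearIndependent.2 h))

theorem gr_empty [IsEmpty ι] (v : ι → E) : gr v = 1 := by simp [gr]

theorem gr_congr (v : ι → E) (w : ι → E') (h : ∀ i j, inner ℝ (v i) (v j) = inner ℝ (w i) (w j)) :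
    gr v = gr w := by
  unfold gr
  congr 1
  ext i j
  simp [Matrix.gram_apply, h]

theorem gr_reindex (e : ι ≃ κ) (v : κ → E) : gr (v ∘ e) = gr v := by
  unfold gr
  have : Matrix.gram ℝ (v ∘ e) = (Matrix.gram ℝ v).submatrix e e := rfl
  rw [this, Matrix.det_submatrix_equiv_self]

theorem gr_lin (A : Matrix ι ι ℝ) (v w : ι → E) (h : ∀ i, v i = ∑ j, A i j • w j) :
    gr v = A.det ^ 2 * gr w := by
  have : Matrix.gram ℝ v = A * Matrix.gram ℝ w * A.transpose := by
    ext i j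
    simp only [Matrix.gram_apply, h, sum_inner, inner_sum, Matrix.mul_apply,
      Matrix.transpose_apply, Finset.sum_mul, real_inner_smul_left, real_inner_smul_right]
    refine Finset.sum_congr rfl fun a _ => Finset.sum_congr rfl fun b _ => ?_
    ring
  unfold gr
  rw [this, Matrix.det_mul, Matrix.det_mul, Matrix.det_transpose]
  ring

theorem gr_int_le {v w : ι → E} (hv : LinearIndependent ℝ v)
    (h : ∀ i, v i ∈ Submodule.span ℤ (Set.range w)) : gr w ≤ gr v := by
  have h' : ∀ i, ∃ c : ι → ℤ, ∑ j, c j • w j = v i := fun i =>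
    (Submodule.mem_span_range_iff_exists_fun ℤ).1 (h i)
  choose A hA using h'
  have h1 := gr_lin (Matrix.of fun i j => ((A i j : ℤ) : ℝ)) v w (by
    intro i
    rw [← hA i]
    simp [Int.cast_smul_eq_zsmul])
  have h2 : (Matrix.of fun i j => ((A i j : ℤ) : ℝ)).det = ((Matrix.of A).det : ℤ) := by
    rw [Int.cast_det]; rfl
  have h3 := gr_pos hv
  rw [h2] at h1
  have h4 : (Matrix.of A).det ≠ 0 := by
    intro h0
    rw [h0] at h1
    simp at h1
    linarith
  have h5 : (1 : ℝ) ≤ (((Matrix.of A).det : ℤ) : ℝ) ^ 2 := by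
    have : (1 : ℤ) ≤ (Matrix.of A).det ^ 2 := by
      have := pow_pos (abs_pos.2 h4) 2
      rw [sq_abs] at this
      omega
    exact_mod_cast this
  rw [h1]
  nlinarith [gr_nonneg w]

/-- Equality of Gram determinants for two real-independent families with the same integral span. -/
theorem gr_eq_of_span {v : ι → E} {w : κ → E} (hv : LinearIndependent ℝ v)
    (hw : LinearIndependent ℝ w) (h : Submodule.span ℤ (Set.range v) = Submodule.span ℤ (Set.range w)) :
    gr v = gr w := by
  have hs : Submodule.span ℝ (Set.range v) = Submodule.span ℝ (Set.range w) := by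
    rw [← Submodule.span_span_of_tower ℤ ℝ (Set.range v), h, Submodule.span_span_of_tower]
  have hc : Fintype.card ι = Fintype.card κ := by
    rw [← finrank_span_eq_card hv, ← finrank_span_eq_card hw, hs]
  let e := Fintype.equivOfCardEq hc
  rw [← gr_reindex e w]
  have hr : Set.range (w ∘ e) = Set.range w := e.surjective.range_comp w
  apply le_antisymm
  · apply gr_int_le (hw.comp e e.injective)
    intro i
    rw [h, ← hr]
    exact Submodule.subset_span ⟨i, rfl⟩
  · apply gr_int_le hv
    intro i
    rw [hr, ← h]
    exact Submodule.subset_span ⟨i, rfl⟩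

open InnerProductSpace in
theorem gr_eq_prod {n : ℕ} (v : Fin n → E) : gr v = ∏ i, ‖gramSchmidt ℝ v i‖ ^ 2 := by
  let A : Matrix (Fin n) (Fin n) ℝ := Matrix.of fun i j =>
    if j = i then 1 else if j < i then
      (inner ℝ (gramSchmidt ℝ v j) (v i) / ‖gramSchmidt ℝ v j‖ ^ 2) else 0
  have hA : A.det = 1 := by
    rw [Matrix.det_of_isLowerTriangular]
    · simp [A]
    · intro i j hij
      have : i < j := hij
      simp [A, this.ne', this.not_gt]
  have h1 := gr_lin A v (gramSchmidt ℝ v) (by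
    intro i
    conv_lhs => rw [gramSchmidt_def'' ℝ v i]
    rw [← Finset.add_sum_erase _ _ (Finset.mem_univ i)]
    congr 1
    · simp [A]
    · have : Finset.Iio i ⊆ Finset.univ.erase i := by
        intro j hj; simp at hj ⊢; exact hj.ne
      rw [← Finset.sum_subset this]
      · refine Finset.sum_congr rfl fun j hj => ?_
        have hj : j < i := by simpa using hj
        simp [A, hj.ne, hj]
      · intro j hj hj'
        have h1 : j ≠ i := by simpa using hj
        have h2 : ¬ j < i := by simpa using hj'
        simp [A, h1, h2])
  rw [h1, hA, one_pow, one_mul]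
  have : Matrix.gram ℝ (gramSchmidt ℝ v) = Matrix.diagonal fun i => ‖gramSchmidt ℝ v i‖ ^ 2 := by
    ext i j
    by_cases hij : i = j
    · subst hij; simp
    · simp [hij, gramSchmidt_orthogonal ℝ v hij]
  unfold gr
  rw [this, Matrix.det_diagonal]

open InnerProductSpace in
theorem gs_le {m n : ℕ} (u : Fin m → E') (v : Fin n → E) (i : Fin m) (j : Fin n) (T : E →ₗ[ℝ] E')
    (hT : ∀ x, ‖T x‖ ≤ ‖x‖) (h : T (v j) = u i)
    (h' : ∀ k < j, T (v k) ∈ Submodule.span ℝ (u '' Set.Iio i)) :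
    ‖gramSchmidt ℝ u i‖ ≤ ‖gramSchmidt ℝ v j‖ := by
  have sub : ∀ {E : Type _} [NormedAddCommGroup E] [InnerProductSpace ℝ E] {n : ℕ} (v : Fin n → E)
      (j : Fin n), v j - gramSchmidt ℝ v j ∈ Submodule.span ℝ (v '' Set.Iio j) := by
    intro E _ _ n v j
    conv => enter [2, 1]; rw [gramSchmidt_def'' ℝ v j]
    rw [add_sub_cancel_left, ← span_gramSchmidt_Iio]
    refine Submodule.sum_mem _ fun k hk => Submodule.smul_mem _ _ (Submodule.subset_span ⟨k, ?_, rfl⟩)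
    simpa using hk
  have sub2 : ∀ {E : Type _} [NormedAddCommGroup E] [InnerProductSpace ℝ E] {n : ℕ} (v : Fin n → E)
      (j : Fin n), v j - gramSchmidt ℝ v j ∈ Submodule.span ℝ (v '' Set.Iio j) := by
    intro E _ _ n v j
    conv => enter [2, 1]; rw [gramSchmidt_def'' ℝ v j]
    rw [add_sub_cancel_left, ← span_gramSchmidt_Iio]
    refine Submodule.sum_mem _ fun k hk => Submodule.smul_mem _ _ (Submodule.subset_span ⟨k, ?_, rfl⟩)
    simpa using hk
  have h1 : T (v j - gramSchmidt ℝ v j) ∈ Submodule.span ℝ (u '' Set.Iio i) := by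
    have h2 := sub v j
    have h3 : Submodule.span ℝ (v '' Set.Iio j) ≤ (Submodule.span ℝ (u '' Set.Iio i)).comap T := by
      rw [Submodule.span_le]
      rintro _ ⟨k, hk, rfl⟩
      exact h' k hk
    exact h3 h2
  have h4 := sub2 u i
  have h5 : T (gramSchmidt ℝ v j) - gramSchmidt ℝ u i ∈ Submodule.span ℝ (u '' Set.Iio i) := by
    have := Submodule.sub_mem _ h4 h1
    rw [map_sub, h] at this
    convert this using 1
    abel
  have h6 : inner ℝ (gramSchmidt ℝ u i) (T (gramSchmidt ℝ v j) - gramSchmidt ℝ u i) = 0 := by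
    rw [← span_gramSchmidt_Iio] at h5
    have : Submodule.span ℝ (gramSchmidt ℝ u '' Set.Iio i) ≤
        LinearMap.ker (innerₛₗ ℝ (gramSchmidt ℝ u i)) := by
      rw [Submodule.span_le]
      rintro _ ⟨k, hk, rfl⟩
      exact gramSchmidt_orthogonal ℝ u (ne_of_gt hk)
    exact this h5
  refine le_trans ?_ (hT _)
  have h7 := norm_add_sq_real (gramSchmidt ℝ u i) (T (gramSchmidt ℝ v j) - gramSchmidt ℝ u i)
  rw [h6, add_sub_cancel] at h7
  apply (sq_le_sq₀ (norm_nonneg _) (norm_nonneg _)).1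
  nlinarith [sq_nonneg ‖T (gramSchmidt ℝ v j) - gramSchmidt ℝ u i‖]

theorem gr_mul_le {k m : ℕ} (b : Fin k → E) (c : Fin m → E) (T : E →ₗ[ℝ] E')
    (hT : ∀ x, ‖T x‖ ≤ ‖x‖) (hb : ∀ i, T (b i) = 0) :
    gr b * gr (fun i => T (c i)) ≤ gr (Sum.elim b c) := by
  have h0 : gr (Sum.elim b c) = gr (Fin.append b c) := by
    rw [← gr_reindex finSumFinEquiv (Fin.append b c)]
    congr 1
    ext x
    rcases x with x | x <;> simp
  rw [h0, gr_eq_prod, gr_eq_prod, gr_eq_prod, Fin.prod_univ_add]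
  refine mul_le_mul ?_ ?_ (Finset.prod_nonneg fun _ _ => by positivity)
    (Finset.prod_nonneg fun _ _ => by positivity)
  · refine Finset.prod_le_prod (fun _ _ => by positivity) fun i _ => ?_
    gcongr
    refine gs_le b _ i _ LinearMap.id (fun x => le_rfl) (by simp) ?_
    intro l hl
    induction l using Fin.addCases with
    | left l =>
      refine Submodule.subset_span ⟨l, ?_, by simp⟩
      have hl' : (l : ℕ) < (i : ℕ) := hl
      exact Fin.lt_def.2 hl'
    | right l => simp [Fin.lt_def] at hl; omega
  · refine Finset.prod_le_prod (fun _ _ => by positivity) fun i _ => ?_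
    gcongr
    refine gs_le _ _ i _ T hT (by simp) ?_
    intro l hl
    induction l using Fin.addCases with
    | left l => simp [hb]
    | right l =>
      refine Submodule.subset_span ⟨l, ?_, by simp⟩
      have hl' : k + (l : ℕ) < k + (i : ℕ) := hl
      exact Fin.lt_def.2 (by omega)

end gramsec
/-! ## Lattices, covolumes and minimal heights -/

section latsec
set_option linter.unusedSectionVars false
variable {E : Type*} [NormedAddCommGroup E] [InnerProductSpace ℝ E] [FiniteDimensional ℝ E]
variable {ι : Type*} [Fintype ι] [DecidableEq ι]

theorem IsLat.exists_basis {L : Submodule ℤ E} (h : IsLat L) :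
    ∃ b : Basis (Fin (finrank ℝ E)) ℝ E, Submodule.span ℤ (Set.range b) = L := by
  obtain ⟨h1, h2⟩ := h
  have : IsZLattice ℝ L := ⟨h2⟩
  let b0 := Module.Free.chooseBasis ℤ L
  let b := b0.ofZLatticeBasis ℝ L
  have hb : Submodule.span ℤ (Set.range b) = L := b0.ofZLatticeBasis_span ℝ
  have hc : Fintype.card (Module.Free.ChooseBasisIndex ℤ L) = finrank ℝ E :=
    (finrank_eq_card_basis b).symm
  refine ⟨b.reindex (Fintype.equivFinOfCardEq hc), ?_⟩
  rw [Basis.range_reindex, hb]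

theorem isLat_of_basis {L : Submodule ℤ E} (b : Basis ι ℝ E)
    (hb : Submodule.span ℤ (Set.range b) = L) : IsLat L := by
  subst hb
  exact ⟨inferInstance, ZSpan.span_top b⟩

theorem covol_eq {L : Submodule ℤ E} (b : Basis ι ℝ E)
    (hb : Submodule.span ℤ (Set.range b) = L) : covol L = Real.sqrt (gr b) := by
  have hZ : LinearIndependent ℤ b := b.linearIndependent.restrict_scalars (R := ℤ) (by
    intro x y hxy
    simpa using hxy)
  let bZ0 : Basis ι ℤ (Submodule.span ℤ (Set.range b)) := Basis.span hZ
  let bZ : Basis ι ℤ L := bZ0.map (LinearEquiv.ofEq _ _ hb)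
  have hex : ∃ n : ℕ, Nonempty (Basis (Fin n) ℤ L) :=
    ⟨_, ⟨bZ.reindex (Fintype.equivFin ι)⟩⟩
  unfold covol
  rw [dif_pos hex]
  set B := hex.choose_spec.some
  change Real.sqrt (gr fun i => ((B i : L) : E)) = _
  congr 1
  have hspan : Submodule.span ℤ (Set.range fun i => ((B i : L) : E)) = L := by
    have h1 : (Set.range fun i => ((B i : L) : E)) = L.subtype '' Set.range B := by
      rw [← Set.range_comp]; rfl
    rw [h1, Submodule.span_image, B.span_eq, Submodule.map_top, Submodule.range_subtype]
  have hcard : Fintype.card (Fin hex.choose) = Fintype.card ι :=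
    Fintype.card_congr (B.indexEquiv bZ)
  have hsp : Submodule.span ℝ (Set.range fun i => ((B i : L) : E)) =
      Submodule.span ℝ (Set.range b) := by
    have h1 := Submodule.span_span_of_tower ℤ ℝ (Set.range b)
    have h2 := Submodule.span_span_of_tower ℤ ℝ (Set.range fun i => ((B i : L) : E))
    rw [hb] at h1
    rw [hspan] at h2
    rw [← h1, ← h2]
  refine gr_eq_of_span ?_ b.linearIndependent (hspan.trans hb.symm)
  rw [linearIndependent_iff_card_eq_finrank_span, hcard, Set.finrank, hsp,
    finrank_span_eq_card b.linearIndependent]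

theorem latIn_discrete {K : Submodule ℤ E} (hK : DiscreteTopology K) (F : Submodule ℝ E) :
    DiscreteTopology (latIn K F) := by
  refine DiscreteTopology.of_continuous_injective (f := fun x : latIn K F =>
    (⟨((x : F) : E), x.2⟩ : K)) ?_ ?_
  · fun_prop
  · intro x y hxy
    apply Subtype.ext
    apply Subtype.ext
    exact congrArg (fun z : K => (z : E)) hxy

theorem latIn_isLat {K : Submodule ℤ E} (hK : DiscreteTopology K) {F : Submodule ℝ E}
    (hF : IsRational K F) : IsLat (latIn K F) := by
  refine ⟨latIn_discrete hK F, ?_⟩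
  apply Submodule.map_injective_of_injective F.subtype_injective
  rw [Submodule.map_span, Submodule.map_top, Submodule.range_subtype]
  conv_rhs => rw [← hF]
  congr 1
  ext x
  constructor
  · rintro ⟨y, hy, rfl⟩
    exact ⟨hy, y.2⟩
  · rintro ⟨h1, h2⟩
    exact ⟨⟨x, h2⟩, h1, rfl⟩

theorem Hr_nonneg (K : Submodule ℤ E) (F : Submodule ℝ E) : 0 ≤ Hr K F := by
  unfold Hr redH
  apply Real.rpow_nonneg
  unfold covol
  split_ifs
  · exact Real.sqrt_nonneg _
  · exact le_rfl

theorem Hmin_nonneg (K : Submodule ℤ E) : 0 ≤ Hmin K := by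
  apply Real.sInf_nonneg
  rintro _ ⟨F, -, -, rfl⟩
  exact Hr_nonneg K F

theorem Hmin_le (K : Submodule ℤ E) {F : Submodule ℝ E} (h : F ≠ ⊥) (hF : IsRational K F) :
    Hmin K ≤ Hr K F := by
  apply csInf_le
  · refine ⟨0, ?_⟩
    rintro _ ⟨F, -, -, rfl⟩
    exact Hr_nonneg K F
  · exact ⟨F, h, hF, rfl⟩

theorem le_Hmin {K : Submodule ℤ E} [Nontrivial E] (hK : IsLat K) {h : ℝ}
    (H : ∀ F : Submodule ℝ E, F ≠ ⊥ → IsRational K F → h ≤ Hr K F) : h ≤ Hmin K := by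
  apply le_csInf
  · refine ⟨_, ⊤, top_ne_bot, ?_, rfl⟩
    unfold IsRational
    simpa using hK.2
  · rintro _ ⟨F, h1, h2, rfl⟩
    exact H F h1 h2

/-- Data of a rational subspace: basis. -/
theorem Hr_data {K : Submodule ℤ E} (hK : DiscreteTopology K) {F : Submodule ℝ E}
    (hF : IsRational K F) :
    ∃ b : Fin (finrank ℝ F) → E, LinearIndependent ℝ b ∧
      (∀ x, x ∈ Submodule.span ℤ (Set.range b) ↔ x ∈ K ∧ x ∈ F) ∧
      (0 < finrank ℝ F → Hr K F ^ (2 * finrank ℝ F) = gr b) := by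
  obtain ⟨B, hB⟩ := (latIn_isLat hK hF).exists_basis
  refine ⟨fun i => (B i : E), ?_, ?_, ?_⟩
  · exact B.linearIndependent.map' F.subtype (Submodule.ker_subtype F)
  · intro x
    have h1 : Set.range (fun i => (B i : E)) = (F.subtype.restrictScalars ℤ) '' Set.range B := by
      rw [← Set.range_comp]; rfl
    rw [h1, Submodule.span_image, hB]
    constructor
    · rintro ⟨y, hy, rfl⟩
      exact ⟨hy, y.2⟩
    · rintro ⟨h1, h2⟩
      exact ⟨⟨x, h2⟩, h1, rfl⟩
  · intro hn
    have h1 : gr (fun i => (B i : E)) = gr B := gr_congr _ _ (fun i j => rfl)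
    rw [h1]
    unfold Hr redH
    rw [covol_eq B hB, mul_comm, pow_mul, Real.rpow_inv_natCast_pow (Real.sqrt_nonneg _) hn.ne',
      Real.sq_sqrt (gr_nonneg _)]

/-- Lemma A. -/
theorem Hmin_pow_le {K : Submodule ℤ E} (hK : DiscreteTopology K) {v : ι → E}
    (hv : LinearIndependent ℝ v) (hvK : ∀ i, v i ∈ K) :
    Hmin K ^ (2 * Fintype.card ι) ≤ gr v := by
  rcases isEmpty_or_nonempty ι with hι | hι
  · simp [gr_empty]
  set F := Submodule.span ℝ (Set.range v) with hFdef
  have hfr : finrank ℝ F = Fintype.card ι := finrank_span_eq_card hv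
  have hpos : 0 < finrank ℝ F := by rw [hfr]; exact Fintype.card_pos
  have hF : IsRational K F := by
    apply le_antisymm
    · rw [Submodule.span_le]; exact Set.inter_subset_right
    · rw [hFdef]
      apply Submodule.span_mono
      rintro _ ⟨i, rfl⟩
      exact ⟨hvK i, Submodule.subset_span ⟨i, rfl⟩⟩
  have hne : F ≠ ⊥ := by
    intro h
    rw [h] at hpos
    simp at hpos
  obtain ⟨b, hb1, hb2, hb3⟩ := Hr_data hK hF
  have h1 : gr b ≤ gr v := by
    let e : ι ≃ Fin (finrank ℝ F) := Fintype.equivFinOfCardEq hfr.symm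
    rw [← gr_reindex e b]
    apply gr_int_le hv
    intro i
    rw [e.surjective.range_comp]
    exact (hb2 _).2 ⟨hvK i, Submodule.subset_span ⟨i, rfl⟩⟩
  refine le_trans ?_ h1
  rw [← hb3 hpos, ← hfr]
  exact pow_le_pow_left₀ (Hmin_nonneg K) (Hmin_le K hne hF) _

/-- Lemma B. -/
theorem le_Hmin_of {K : Submodule ℤ E} [Nontrivial E] (hK : IsLat K) {h : ℝ}
    (H : ∀ (n : ℕ) (v : Fin n → E), LinearIndependent ℝ v → (∀ i, v i ∈ K) → h ^ (2 * n) ≤ gr v) :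
    h ≤ Hmin K := by
  apply le_Hmin hK
  intro F hne hF
  obtain ⟨b, hb1, hb2, hb3⟩ := Hr_data hK.1 hF
  have hpos : 0 < finrank ℝ F := by
    rw [Nat.pos_iff_ne_zero, Ne, Submodule.finrank_eq_zero]; exact hne
  have h1 := H _ b hb1 (fun i => ((hb2 _).1 (Submodule.subset_span ⟨i, rfl⟩)).1)
  rw [← hb3 hpos] at h1
  exact le_of_pow_le_pow_left₀ (by omega) (Hr_nonneg K F) h1

/-- Integral independence implies real independence inside a discrete lattice. -/
theorem real_indep_of_int {K : Submodule ℤ E} (hK : DiscreteTopology K) {v : ι → E}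
    (hv : LinearIndependent ℤ v) (hvK : ∀ i, v i ∈ K) : LinearIndependent ℝ v := by
  have hle : Submodule.span ℤ (Set.range v) ≤ K := by
    rw [Submodule.span_le]; rintro _ ⟨i, rfl⟩; exact hvK i
  have hd : DiscreteTopology (Submodule.span ℤ (Set.range v)) :=
    DiscreteTopology.of_subset hK hle
  rw [linearIndependent_iff_card_eq_finrank_span, Real.finrank_eq_int_finrank_of_discrete hd,
    Set.finrank, finrank_span_eq_card hv]

/-- Splitting of a finitely generated lattice along a linear map. -/
theorem exists_split {E' : Type*} [NormedAddCommGroup E'] [InnerProductSpace ℝ E']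
    (N : Submodule ℤ E) [Module.Finite ℤ N] (P : E →ₗ[ℝ] E') :
    ∃ (k m : ℕ) (b : Fin k → E) (c : Fin m → E),
      LinearIndependent ℤ (Sum.elim b c) ∧
      Submodule.span ℤ (Set.range (Sum.elim b c)) = N ∧
      (∀ i, P (b i) = 0) ∧ LinearIndependent ℤ (fun i => P (c i)) ∧
      (∀ x ∈ N, P x = 0 → x ∈ Submodule.span ℤ (Set.range b)) := by
  let f : N →ₗ[ℤ] E' := (P.restrictScalars ℤ).comp N.subtype
  have : Module ℚ E := Module.compHom E (algebraMap ℚ ℝ)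
  have : IsAddTorsionFree E := .of_module_rat _
  have : Module ℚ E' := Module.compHom E' (algebraMap ℚ ℝ)
  have : IsAddTorsionFree E' := .of_module_rat _
  let b0 := Module.finBasis ℤ (LinearMap.ker f)
  let c0 := Module.finBasis ℤ (LinearMap.range f)
  have hc : ∀ i, ∃ x : N, f x = (c0 i : E') := fun i => (c0 i).2
  choose c1 hc1 using hc
  have hPb : ∀ i, P ((b0 i : N) : E) = 0 := fun i => (b0 i).2
  have hPc : ∀ i, P ((c1 i : N) : E) = (c0 i : E') := fun i => hc1 i
  have hcind : LinearIndependent ℤ (fun i => P ((c1 i : N) : E)) := by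
    simp_rw [hPc]
    exact c0.linearIndependent.map' (LinearMap.range f).subtype (Submodule.ker_subtype _)
  have hbind : LinearIndependent ℤ (fun i => ((b0 i : N) : E)) :=
    (b0.linearIndependent.map' (LinearMap.ker f).subtype (Submodule.ker_subtype _)).map'
      N.subtype (Submodule.ker_subtype _)
  have hker : ∀ x ∈ N, P x = 0 → x ∈ Submodule.span ℤ (Set.range fun i => ((b0 i : N) : E)) := by
    intro x hx hPx
    have h1 : (⟨⟨x, hx⟩, hPx⟩ : LinearMap.ker f) ∈ Submodule.span ℤ (Set.range b0) := by
      rw [b0.span_eq]; trivial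
    have h2 := Submodule.mem_map_of_mem (f := N.subtype.comp (LinearMap.ker f).subtype) h1
    rw [Submodule.map_span, ← Set.range_comp] at h2
    exact h2
  refine ⟨_, _, fun i => ((b0 i : N) : E), fun i => ((c1 i : N) : E), ?_, ?_, hPb, hcind, hker⟩
  · rw [linearIndependent_sum]
    refine ⟨hbind, ?_, ?_⟩
    · exact LinearIndependent.of_comp (P.restrictScalars ℤ) hcind
    · have hd := hcind
      rw [Submodule.disjoint_def]
      intro x hx hx'
      have hPx : P x = 0 := by
        have : Submodule.span ℤ (Set.range (Sum.elim (fun i => ((b0 i : N) : E))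
            (fun i => ((c1 i : N) : E)) ∘ Sum.inl)) ≤ LinearMap.ker (P.restrictScalars ℤ) := by
          rw [Submodule.span_le]
          rintro _ ⟨i, rfl⟩
          exact hPb i
        exact this hx
      obtain ⟨a, rfl⟩ := (Submodule.mem_span_range_iff_exists_fun ℤ).1 hx'
      have h0 : ∑ i, a i • P ((c1 i : N) : E) = 0 := by
        rw [← hPx, map_sum]
        simp
      have := Fintype.linearIndependent_iff.1 hcind a h0
      simp [this]
  · apply le_antisymm
    · rw [Submodule.span_le]
      rintro _ ⟨i | i, rfl⟩
      · exact (b0 i : N).2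
      · exact (c1 i : N).2
    · intro x hx
      have h1 : (⟨P x, ⟨⟨x, hx⟩, rfl⟩⟩ : LinearMap.range f) ∈ Submodule.span ℤ (Set.range c0) := by
        rw [c0.span_eq]; trivial
      obtain ⟨a, ha⟩ := (Submodule.mem_span_range_iff_exists_fun ℤ).1 h1
      have ha' : P x = ∑ i, a i • (c0 i : E') := by
        have := congrArg (fun z : LinearMap.range f => (z : E')) ha
        simpa using this.symm
      have h2 : x - ∑ i, a i • ((c1 i : N) : E) ∈
          Submodule.span ℤ (Set.range fun i => ((b0 i : N) : E)) := by
        apply hker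
        · exact N.sub_mem hx (N.sum_mem fun i _ => N.smul_mem _ (c1 i).2)
        · rw [map_sub, ha', map_sum]
          simp [hPc]
      rw [Set.Sum.elim_range, Submodule.span_union]
      rw [← sub_add_cancel x (∑ i, a i • ((c1 i : N) : E))]
      exact Submodule.add_mem_sup h2
        (Submodule.sum_mem _ fun i _ => Submodule.smul_mem _ _ (Submodule.subset_span ⟨i, rfl⟩))

end latsec
section tenssec
set_option linter.unusedSectionVars false
variable {E F G : Type*} [NormedAddCommGroup E] [InnerProductSpace ℝ E] [FiniteDimensional ℝ E]
  [NormedAddCommGroup F] [InnerProductSpace ℝ F] [FiniteDimensional ℝ F]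
  [NormedAddCommGroup G] [InnerProductSpace ℝ G]
variable {ι κ : Type*} [Fintype ι] [DecidableEq ι] [Fintype κ] [DecidableEq κ]

theorem quotLat_isLat {L : Submodule ℤ E} (hL : IsLat L) {V : Submodule ℝ E}
    (hV : IsRational L V) : IsLat (quotLat L V) := by
  obtain ⟨hd, hs⟩ := hL
  let P : E →ₗ[ℝ] Vᗮ := (Submodule.orthogonalProjectionOnto Vᗮ : E →ₗ[ℝ] Vᗮ)
  have hkerP : ∀ x, P x = 0 ↔ x ∈ V := by
    intro x
    have : P x = 0 ↔ x ∈ Vᗮᗮ := Submodule.orthogonalProjectionOnto_eq_zero_iff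
    rw [this, Submodule.orthogonal_orthogonal]
  obtain ⟨k, m, b, c, h1, h2, h3, h4, h5⟩ := exists_split L P
  have hmem : ∀ i, Sum.elim b c i ∈ L := fun i => h2 ▸ Submodule.subset_span ⟨i, rfl⟩
  have hR := real_indep_of_int hd h1 hmem
  rw [linearIndependent_sum] at hR
  obtain ⟨hR1, hR2, hR3⟩ := hR
  have hVb : V ≤ Submodule.span ℝ (Set.range b) := by
    rw [← hV, Submodule.span_le]
    rintro x ⟨hx1, hx2⟩
    have := h5 x hx1 ((hkerP x).2 hx2)
    exact Submodule.span_le_restrictScalars ℤ ℝ _ this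
  have hind : LinearIndependent ℝ (fun i => P (c i)) := by
    refine LinearIndependent.map hR2 ?_
    refine Disjoint.mono_right ?_ hR3.symm
    intro x hx
    exact hVb ((hkerP x).1 hx)
  have hquot : Submodule.span ℤ (Set.range fun i => P (c i)) = quotLat L V := by
    unfold quotLat
    rw [← h2, Submodule.map_span, ← Set.range_comp]
    apply le_antisymm
    · apply Submodule.span_mono
      rintro _ ⟨i, rfl⟩
      exact ⟨Sum.inr i, rfl⟩
    · rw [Submodule.span_le]
      rintro _ ⟨i | i, rfl⟩
      · have : P (b i) = 0 := h3 i
        change P (b i) ∈ _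
        rw [this]
        exact Submodule.zero_mem _
      · exact Submodule.subset_span ⟨i, rfl⟩
  have hsp : Submodule.span ℝ (quotLat L V : Set Vᗮ) = ⊤ := by
    have : (quotLat L V : Set Vᗮ) = P '' L := rfl
    rw [this, Submodule.span_image, hs, Submodule.map_top, LinearMap.range_eq_top]
    intro y
    exact ⟨y, by simp [P]⟩
  have hsp2 : ⊤ ≤ Submodule.span ℝ (Set.range fun i => P (c i)) := by
    rw [← hsp, ← hquot, Submodule.span_span_of_tower]
  refine isLat_of_basis (Basis.mk hind hsp2) ?_
  rw [Basis.coe_mk, hquot]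

theorem comap_rational {M : Submodule ℤ F} {V W : Submodule ℝ F} (hVW : V ≤ W)
    (hV : IsRational M V) : IsRational (latIn M W) (V.comap W.subtype) := by
  unfold IsRational
  apply Submodule.map_injective_of_injective W.subtype_injective
  rw [Submodule.map_span, Submodule.map_comap_subtype, inf_eq_right.2 hVW]
  conv_rhs => rw [← hV]
  congr 1
  ext x
  constructor
  · rintro ⟨y, ⟨hy1, hy2⟩, rfl⟩
    exact ⟨hy1, hy2⟩
  · rintro ⟨h1, h2⟩
    exact ⟨⟨x, hVW h2⟩, ⟨h1, h2⟩, rfl⟩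

theorem succQuot_isLat {M : Submodule ℤ F} (hM : IsLat M) {V W : Submodule ℝ F} (hVW : V ≤ W)
    (hV : IsRational M V) (hW : IsRational M W) : IsLat (succQuot M V W) :=
  quotLat_isLat (latIn_isLat hM.1 hW) (comap_rational hVW hV)

/-- The linear equivalence of a tensor realization. -/
def tEquiv {tp : E →ₗ[ℝ] F →ₗ[ℝ] G} (h : IsTensor tp) : TensorProduct ℝ E F ≃ₗ[ℝ] G :=
  LinearEquiv.ofBijective (TensorProduct.lift tp) h.1

theorem tEquiv_tmul {tp : E →ₗ[ℝ] F →ₗ[ℝ] G} (h : IsTensor tp) (x : E) (y : F) :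
    tEquiv h (x ⊗ₜ y) = tp x y := by
  simp [tEquiv]

theorem tEquiv_symm {tp : E →ₗ[ℝ] F →ₗ[ℝ] G} (h : IsTensor tp) (x : E) (y : F) :
    (tEquiv h).symm (tp x y) = x ⊗ₜ y := by
  rw [LinearEquiv.symm_apply_eq, tEquiv_tmul]

/-- Product basis. -/
def tBasis {tp : E →ₗ[ℝ] F →ₗ[ℝ] G} (h : IsTensor tp) (x : Basis ι ℝ E) (y : Basis κ ℝ F) :
    Basis (ι × κ) ℝ G := (x.tensorProduct y).map (tEquiv h)

theorem tBasis_apply {tp : E →ₗ[ℝ] F →ₗ[ℝ] G} (h : IsTensor tp) (x : Basis ι ℝ E)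
    (y : Basis κ ℝ F) (p : ι × κ) : tBasis h x y p = tp (x p.1) (y p.2) := by
  simp [tBasis, Basis.tensorProduct_apply', tEquiv_tmul]

theorem tensor_finite {tp : E →ₗ[ℝ] F →ₗ[ℝ] G} (h : IsTensor tp) : FiniteDimensional ℝ G :=
  (tEquiv h).finiteDimensional

theorem tensorLat_expand {tp : E →ₗ[ℝ] F →ₗ[ℝ] G} {L : Submodule ℤ E} (M : Submodule ℤ F)
    {x : ι → E} (hx : Submodule.span ℤ (Set.range x) = L) {g : G} (hg : g ∈ tensorLat tp L M) :
    ∃ y : ι → F, (∀ i, y i ∈ M) ∧ g = ∑ i, tp (x i) (y i) := by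
  unfold tensorLat at hg
  induction hg using Submodule.span_induction with
  | mem g hg =>
    obtain ⟨a, ha, f, hf, rfl⟩ := hg
    have ha : a ∈ Submodule.span ℤ (Set.range x) := by rw [hx]; exact ha
    obtain ⟨n, rfl⟩ := (Submodule.mem_span_range_iff_exists_fun ℤ).1 ha
    refine ⟨fun i => n i • f, fun i => M.smul_mem _ hf, ?_⟩
    simp [map_sum, LinearMap.sum_apply]
  | zero => exact ⟨0, fun i => M.zero_mem, by simp⟩
  | add a b _ _ ha hb =>
    obtain ⟨y, hy, rfl⟩ := ha
    obtain ⟨z, hz, rfl⟩ := hb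
    exact ⟨y + z, fun i => M.add_mem (hy i) (hz i), by simp [Finset.sum_add_distrib]⟩
  | smul n a _ ha =>
    obtain ⟨y, hy, rfl⟩ := ha
    exact ⟨fun i => n • y i, fun i => M.smul_mem _ (hy i), by simp [Finset.smul_sum]⟩

theorem mem_tensorLat {tp : E →ₗ[ℝ] F →ₗ[ℝ] G} {L : Submodule ℤ E} {M : Submodule ℤ F}
    {x : E} {y : F} (hx : x ∈ L) (hy : y ∈ M) : tp x y ∈ tensorLat tp L M :=
  Submodule.subset_span ⟨x, hx, y, hy, rfl⟩

theorem tensor_isLat {tp : E →ₗ[ℝ] F →ₗ[ℝ] G} (h : IsTensor tp) {L : Submodule ℤ E}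
    {M : Submodule ℤ F} (hL : IsLat L) (hM : IsLat M) : IsLat (tensorLat tp L M) := by
  obtain ⟨x, hx⟩ := hL.exists_basis
  obtain ⟨y, hy⟩ := hM.exists_basis
  have := tensor_finite h
  refine isLat_of_basis (tBasis h x y) ?_
  apply le_antisymm
  · rw [Submodule.span_le]
    rintro _ ⟨p, rfl⟩
    rw [tBasis_apply]
    exact mem_tensorLat (hx ▸ Submodule.subset_span ⟨_, rfl⟩) (hy ▸ Submodule.subset_span ⟨_, rfl⟩)
  · intro g hg
    obtain ⟨z, hz, rfl⟩ := tensorLat_expand M hx hg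
    refine Submodule.sum_mem _ fun i _ => ?_
    have hzi : z i ∈ Submodule.span ℤ (Set.range y) := by rw [hy]; exact hz i
    obtain ⟨n, hn⟩ := (Submodule.mem_span_range_iff_exists_fun ℤ).1 hzi
    rw [← hn, map_sum]
    refine Submodule.sum_mem _ fun j _ => ?_
    rw [map_zsmul]
    refine Submodule.smul_mem _ _ (Submodule.subset_span ⟨(i, j), ?_⟩)
    rw [tBasis_apply]

theorem tensor_expand {tp : E →ₗ[ℝ] F →ₗ[ℝ] G} (h : IsTensor tp) (x : Basis ι ℝ E) (g : G) :
    ∃ y : ι → F, g = ∑ i, tp (x i) (y i) := by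
  obtain ⟨z, rfl⟩ := (tEquiv h).surjective g
  induction z using TensorProduct.induction_on with
  | zero => exact ⟨0, by simp⟩
  | tmul a f =>
    refine ⟨fun i => x.repr a i • f, ?_⟩
    rw [tEquiv_tmul]
    conv_lhs => rw [← x.sum_repr a, map_sum, LinearMap.sum_apply]
    simp
  | add a b ha hb =>
    obtain ⟨y, hy⟩ := ha
    obtain ⟨z, hz⟩ := hb
    exact ⟨y + z, by simp [hy, hz, Finset.sum_add_distrib]⟩

theorem tensor_indep {tp : E →ₗ[ℝ] F →ₗ[ℝ] G} (h : IsTensor tp) (x : Basis ι ℝ E) (y : ι → F)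
    (h0 : ∑ i, tp (x i) (y i) = 0) (i : ι) : y i = 0 := by
  have h1 : ∑ i, x i ⊗ₜ[ℝ] y i = 0 := by
    apply (tEquiv h).injective
    rw [map_sum, map_zero, ← h0]
    simp [tEquiv_tmul]
  have h2 := congrArg ((TensorProduct.lid ℝ F).toLinearMap ∘ₗ (LinearMap.rTensor F (x.coord i))) h1
  simp only [map_sum, map_zero, LinearMap.comp_apply, LinearMap.rTensor_tmul,
    LinearEquiv.coe_coe, TensorProduct.lid_tmul, Basis.coord_apply, Basis.repr_self] at h2
  rw [Finset.sum_eq_single i] at h2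
  · simpa using h2
  · intro j _ hj
    simp [hj]
  · simp

/-- Existence of a tensor product realization in any universe. -/
theorem exists_tensor.{w} : ∃ (H : Type w) (_ : NormedAddCommGroup H)
    (_ : InnerProductSpace ℝ H) (tp : E →ₗ[ℝ] F →ₗ[ℝ] H), IsTensor tp := by
  let T := TensorProduct ℝ E F
  let e : T ≃ₗᵢ[ℝ] EuclideanSpace ℝ (ULift.{w} (Fin (finrank ℝ T))) :=
    ((stdOrthonormalBasis ℝ T).reindex Equiv.ulift.symm).repr
  refine ⟨EuclideanSpace ℝ (ULift.{w} (Fin (finrank ℝ T))), inferInstance, inferInstance,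
    (TensorProduct.mk ℝ E F).compr₂ e.toLinearEquiv.toLinearMap, ?_, ?_⟩
  · rw [TensorProduct.lift_compr₂, TensorProduct.lift_mk, LinearMap.comp_id]
    exact e.bijective
  · intro a a' f f'
    have : inner ℝ (e (a ⊗ₜ f)) (e (a' ⊗ₜ f')) = inner ℝ a a' * inner ℝ f f' := by
      rw [e.inner_map_map, TensorProduct.inner_tmul]
    exact this

end tenssec
section mainsec
set_option linter.unusedSectionVars false
variable {E F G F' G' : Type*} [NormedAddCommGroup E] [InnerProductSpace ℝ E]
  [FiniteDimensional ℝ E]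
  [NormedAddCommGroup F] [InnerProductSpace ℝ F] [FiniteDimensional ℝ F]
  [NormedAddCommGroup G] [InnerProductSpace ℝ G]
  [NormedAddCommGroup F'] [InnerProductSpace ℝ F'] [FiniteDimensional ℝ F']
  [NormedAddCommGroup G'] [InnerProductSpace ℝ G']

def tMap {tp : E →ₗ[ℝ] F →ₗ[ℝ] G} (h : IsTensor tp) (tp' : E →ₗ[ℝ] F' →ₗ[ℝ] G')
    (π : F →ₗ[ℝ] F') : G →ₗ[ℝ] G' :=
  (TensorProduct.lift tp') ∘ₗ (LinearMap.lTensor E π) ∘ₗ (tEquiv h).symm.toLinearMap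

theorem tMap_apply {tp : E →ₗ[ℝ] F →ₗ[ℝ] G} (h : IsTensor tp) (tp' : E →ₗ[ℝ] F' →ₗ[ℝ] G')
    (π : F →ₗ[ℝ] F') (x : E) (y : F) : tMap h tp' π (tp x y) = tp' x (π y) := by
  simp [tMap, tEquiv_symm]

theorem tensor_norm {tp : E →ₗ[ℝ] F →ₗ[ℝ] G} (h : IsTensor tp) {n : ℕ}
    (x : OrthonormalBasis (Fin n) ℝ E) (y : Fin n → F) :
    ‖∑ i, tp (x i) (y i)‖ ^ 2 = ∑ i, ‖y i‖ ^ 2 := by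
  rw [← real_inner_self_eq_norm_sq]
  simp only [sum_inner, inner_sum, h.2, x.inner_eq_ite, ite_mul, one_mul, zero_mul]
  simp

theorem tMap_norm_le {tp : E →ₗ[ℝ] F →ₗ[ℝ] G} (h : IsTensor tp) {tp' : E →ₗ[ℝ] F' →ₗ[ℝ] G'}
    (h' : IsTensor tp') {π : F →ₗ[ℝ] F'} (hπ : ∀ y, ‖π y‖ ≤ ‖y‖) (g : G) :
    ‖tMap h tp' π g‖ ≤ ‖g‖ := by
  let x := stdOrthonormalBasis ℝ E
  obtain ⟨y, rfl⟩ := tensor_expand h x.toBasis g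
  simp only [OrthonormalBasis.coe_toBasis]
  apply (sq_le_sq₀ (norm_nonneg _) (norm_nonneg _)).1
  rw [map_sum]
  simp only [tMap_apply]
  rw [tensor_norm h x, tensor_norm h' x]
  exact Finset.sum_le_sum fun i _ => pow_le_pow_left₀ (norm_nonneg _) (hπ _) 2

/-- Inductive step along the filtration. -/
theorem step {tp : E →ₗ[ℝ] F →ₗ[ℝ] G} (h : IsTensor tp) {tp' : E →ₗ[ℝ] F' →ₗ[ℝ] G'}
    (h' : IsTensor tp') {L : Submodule ℤ E} {M₁ M₂ : Submodule ℤ F} {Q : Submodule ℤ F'}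
    (hL : IsLat L) (hQ : IsLat Q) {π : F →ₗ[ℝ] F'} (hπ : ∀ y, ‖π y‖ ≤ ‖y‖)
    (hπQ : ∀ y ∈ M₂, π y ∈ Q) (hker : ∀ y ∈ M₂, π y = 0 → y ∈ M₁)
    {r : ℝ} (hr0 : 0 ≤ r) (hr : r ≤ Hmin (tensorLat tp' L Q))
    (IH : ∀ (n : ℕ) (v : Fin n → G), LinearIndependent ℝ v → (∀ i, v i ∈ tensorLat tp L M₁) →
      r ^ (2 * n) ≤ gr v) :
    ∀ (n : ℕ) (v : Fin n → G), LinearIndependent ℝ v → (∀ i, v i ∈ tensorLat tp L M₂) →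
      r ^ (2 * n) ≤ gr v := by
  intro n v hv hvM
  have hG := tensor_finite h
  have hG' := tensor_finite h'
  obtain ⟨x, hx⟩ := hL.exists_basis
  let P := tMap h tp' π
  let N := Submodule.span ℤ (Set.range v)
  have hN : N ≤ tensorLat tp L M₂ := by
    rw [Submodule.span_le]; rintro _ ⟨i, rfl⟩; exact hvM i
  have : Module.Finite ℤ N := Module.Finite.span_of_finite ℤ (Set.finite_range v)
  obtain ⟨k, m, b, c, h1, h2, h3, h4, h5⟩ := exists_split N P
  have hmem : ∀ i, Sum.elim b c i ∈ N := fun i => h2 ▸ Submodule.subset_span ⟨i, rfl⟩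
  have hvZ : LinearIndependent ℤ v := hv.restrict_scalars (R := ℤ) (by
    intro x y hxy
    simpa using hxy)
  have hcard : k + m = n := by
    have e1 := finrank_span_eq_card h1
    have e2 := finrank_span_eq_card hvZ
    rw [h2] at e1
    rw [e2] at e1
    simpa using e1.symm
  have hsp : Submodule.span ℝ (Set.range (Sum.elim b c)) = Submodule.span ℝ (Set.range v) := by
    rw [← Submodule.span_span_of_tower ℤ ℝ (Set.range (Sum.elim b c)), h2,
      Submodule.span_span_of_tower]
  have hbc : LinearIndependent ℝ (Sum.elim b c) := by
    rw [linearIndependent_iff_card_eq_finrank_span, Set.finrank, hsp, finrank_span_eq_card hv]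
    simpa using hcard
  have hb : LinearIndependent ℝ b := (linearIndependent_sum.1 hbc).1
  have hgr : gr v = gr (Sum.elim b c) := gr_eq_of_span hv hbc h2.symm
  have hI1 : r ^ (2 * k) ≤ gr b := by
    apply IH k b hb
    intro i
    obtain ⟨y, hy, hy'⟩ := tensorLat_expand M₂ hx (hN (hmem (Sum.inl i)))
    simp only [Sum.elim_inl] at hy'
    have h0 := h3 i
    rw [hy', map_sum] at h0
    simp only [P, tMap_apply] at h0
    have h6 := tensor_indep h' x (fun i => π (y i)) h0
    rw [hy']
    exact Submodule.sum_mem _ fun j _ =>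
      mem_tensorLat (hx ▸ Submodule.subset_span ⟨_, rfl⟩) (hker _ (hy j) (h6 j))
  have hlat := tensor_isLat h' hL hQ
  have hPc : ∀ i, P (c i) ∈ tensorLat tp' L Q := by
    intro i
    obtain ⟨y, hy, hy'⟩ := tensorLat_expand M₂ hx (hN (hmem (Sum.inr i)))
    simp only [Sum.elim_inr] at hy'
    rw [hy', map_sum]
    refine Submodule.sum_mem _ fun j _ => ?_
    simp only [P, tMap_apply]
    exact mem_tensorLat (hx ▸ Submodule.subset_span ⟨_, rfl⟩) (hπQ _ (hy j))
  have hI2 : r ^ (2 * m) ≤ gr (fun i => P (c i)) := by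
    have := Hmin_pow_le hlat.1 (real_indep_of_int hlat.1 h4 hPc) hPc
    rw [Fintype.card_fin] at this
    exact le_trans (pow_le_pow_left₀ hr0 hr _) this
  have hI3 := gr_mul_le b c P (tMap_norm_le h h' hπ) h3
  rw [hgr, ← hcard, mul_add, pow_add]
  exact le_trans (mul_le_mul hI1 hI2 (by positivity) (gr_nonneg _)) hI3

/-- Upper bound. -/
theorem Hmin_tensor_le {tp : E →ₗ[ℝ] F →ₗ[ℝ] G} (h : IsTensor tp) [Nontrivial E] [Nontrivial F]
    {L : Submodule ℤ E} {M : Submodule ℤ F} (hL : IsLat L) (hM : IsLat M) :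
    Hmin (tensorLat tp L M) ≤ Hmin L * Hmin M := by
  have hG := tensor_finite h
  have hlat := tensor_isLat h hL hM
  have key : ∀ A : Submodule ℝ E, A ≠ ⊥ → IsRational L A → ∀ B : Submodule ℝ F, B ≠ ⊥ →
      IsRational M B → Hmin (tensorLat tp L M) ≤ Hr L A * Hr M B := by
    intro A hA hAr B hB hBr
    obtain ⟨a, ha1, ha2, ha3⟩ := Hr_data hL.1 hAr
    obtain ⟨b, hb1, hb2, hb3⟩ := Hr_data hM.1 hBr
    have hp : 0 < finrank ℝ A := by
      rw [Nat.pos_iff_ne_zero, Ne, Submodule.finrank_eq_zero]; exact hA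
    have hq : 0 < finrank ℝ B := by
      rw [Nat.pos_iff_ne_zero, Ne, Submodule.finrank_eq_zero]; exact hB
    specialize ha3 hp
    specialize hb3 hq
    let v : Fin (finrank ℝ A) × Fin (finrank ℝ B) → G := fun p => tp (a p.1) (b p.2)
    have hgr : gr v = gr a ^ finrank ℝ B * gr b ^ finrank ℝ A := by
      have : Matrix.gram ℝ v = Matrix.kroneckerMap (fun s t => s * t) (Matrix.gram ℝ a) (Matrix.gram ℝ b) := by
        ext p q
        simp [v, h.2, Matrix.gram_apply]
      unfold gr
      rw [this, Matrix.det_kronecker]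
      simp
    have hv : LinearIndependent ℝ v := by
      apply Matrix.det_gram_ne_zero_iff_linearIndependent.1
      change gr v ≠ 0
      rw [hgr]
      have := gr_pos ha1
      have := gr_pos hb1
      positivity
    have hI := Hmin_pow_le hlat.1 hv (fun p => mem_tensorLat
      ((ha2 _).1 (Submodule.subset_span ⟨_, rfl⟩)).1 ((hb2 _).1 (Submodule.subset_span ⟨_, rfl⟩)).1)
    rw [hgr, ← ha3, ← hb3] at hI
    simp only [Fintype.card_prod, Fintype.card_fin] at hI
    refine le_of_pow_le_pow_left₀ (n := 2 * (finrank ℝ A * finrank ℝ B)) (by positivity)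
      (mul_nonneg (Hr_nonneg _ _) (Hr_nonneg _ _)) (hI.trans (le_of_eq ?_))
    ring
  have hpos : ∀ B : Submodule ℝ F, B ≠ ⊥ → IsRational M B → 0 < Hr M B := by
    intro B hB hBr
    obtain ⟨b, hb1, hb2, hb3⟩ := Hr_data hM.1 hBr
    have hq : 0 < finrank ℝ B := by
      rw [Nat.pos_iff_ne_zero, Ne, Submodule.finrank_eq_zero]; exact hB
    have h1 := gr_pos hb1
    rw [← hb3 hq] at h1
    exact lt_of_le_of_ne (Hr_nonneg _ _) (fun h0 => by
      rw [← h0, zero_pow (by omega)] at h1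
      exact lt_irrefl _ h1)
  have key2 : ∀ B : Submodule ℝ F, B ≠ ⊥ → IsRational M B →
      Hmin (tensorLat tp L M) ≤ Hmin L * Hr M B := by
    intro B hB hBr
    rw [← div_le_iff₀ (hpos B hB hBr)]
    apply le_Hmin hL
    intro A hA hAr
    rw [div_le_iff₀ (hpos B hB hBr)]
    exact key A hA hAr B hB hBr
  rcases (Hmin_nonneg L).eq_or_lt with h0 | h0
  · have := key2 ⊤ top_ne_bot (by unfold IsRational; simpa using hM.2)
    rw [← h0, zero_mul] at this ⊢
    exact this
  · rw [mul_comm, ← div_le_iff₀ h0]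
    apply le_Hmin hM
    intro B hB hBr
    rw [div_le_iff₀ h0, mul_comm]
    exact key2 B hB hBr

theorem Hmin_subsingleton [Subsingleton E] (L : Submodule ℤ E) : Hmin L = 0 := by
  have : {h : ℝ | ∃ F : Submodule ℝ E, F ≠ ⊥ ∧ IsRational L F ∧ h = Hr L F} = ∅ := by
    ext y
    simp only [Set.mem_ofPred_eq, Set.mem_empty_iff_false, iff_false]
    rintro ⟨F, h1, -⟩
    exact h1 (Subsingleton.elim _ _)
  unfold Hmin
  rw [this, Real.sInf_empty]

/-- The projection of the ambient space onto a successive quotient. -/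
def sqProj (V W : Submodule ℝ F) : F →ₗ[ℝ] ↥((V.comap W.subtype)ᗮ) :=
  (Submodule.orthogonalProjectionOnto ((V.comap W.subtype)ᗮ) : W →ₗ[ℝ] ↥((V.comap W.subtype)ᗮ)) ∘ₗ
    (Submodule.orthogonalProjectionOnto W : F →ₗ[ℝ] W)

theorem sqProj_norm_le (V W : Submodule ℝ F) (y : F) : ‖sqProj V W y‖ ≤ ‖y‖ := by
  have h1 := Submodule.norm_orthogonalProjectionOnto_apply_le ((V.comap W.subtype)ᗮ)
    (Submodule.orthogonalProjectionOnto W y)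
  have h2 := Submodule.norm_orthogonalProjectionOnto_apply_le W y
  exact h1.trans h2

theorem sqProj_of_mem (V W : Submodule ℝ F) {y : F} (hy : y ∈ W) :
    sqProj V W y = Submodule.orthogonalProjectionOnto ((V.comap W.subtype)ᗮ) (⟨y, hy⟩ : W) := by
  have : Submodule.orthogonalProjectionOnto W y = ⟨y, hy⟩ :=
    Submodule.orthogonalProjectionOnto_mem_subspace_eq_self (⟨y, hy⟩ : W)
  unfold sqProj
  rw [← this]
  rfl

theorem sqProj_mem (M : Submodule ℤ F) (V W : Submodule ℝ F) {y : F} (hM : y ∈ M) (hy : y ∈ W) :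
    sqProj V W y ∈ succQuot M V W := by
  rw [sqProj_of_mem V W hy]
  exact ⟨⟨y, hy⟩, hM, rfl⟩

theorem sqProj_ker (V W : Submodule ℝ F) {y : F} (hy : y ∈ W) (h0 : sqProj V W y = 0) : y ∈ V := by
  rw [sqProj_of_mem V W hy, Submodule.orthogonalProjectionOnto_eq_zero_iff,
    Submodule.orthogonal_orthogonal] at h0
  exact h0

theorem Hmin_first {M : Submodule ℤ F} (hM : IsLat M) {W : Submodule ℝ F} (hW : IsRational M W)
    (hne : W ≠ ⊥) : Hmin M ≤ Hmin (succQuot M ⊥ W) := by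
  have hQ : IsLat (succQuot M ⊥ W) :=
    succQuot_isLat hM bot_le (by unfold IsRational; apply le_antisymm <;> simp) hW
  have hmem : ∀ z : W, z ∈ ((⊥ : Submodule ℝ F).comap W.subtype)ᗮ := by
    intro z w hw
    have hw0 : w = 0 := by
      apply Subtype.ext
      simpa using hw
    rw [hw0, inner_zero_left]
  have hnt : Nontrivial ↥(((⊥ : Submodule ℝ F).comap W.subtype)ᗮ) := by
    obtain ⟨z, hz, hz0⟩ := Submodule.exists_mem_ne_zero_of_ne_bot hne
    refine ⟨⟨⟨⟨z, hz⟩, hmem _⟩, 0, ?_⟩⟩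
    intro h0
    apply hz0
    exact congrArg (fun u : ↥(((⊥ : Submodule ℝ F).comap W.subtype)ᗮ) => ((u : W) : F)) h0
  apply le_Hmin_of hQ
  intro n v hv hvQ
  have h1 : LinearIndependent ℝ (fun i => ((v i : W) : F)) :=
    (hv.map' (Submodule.subtype _) (Submodule.ker_subtype _)).map' W.subtype
      (Submodule.ker_subtype _)
  have h2 : ∀ i, ((v i : W) : F) ∈ M := by
    intro i
    obtain ⟨z, hz, hz'⟩ := hvQ i
    have : Submodule.orthogonalProjectionOnto (((⊥ : Submodule ℝ F).comap W.subtype)ᗮ) z =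
        ⟨z, hmem z⟩ :=
      Submodule.orthogonalProjectionOnto_mem_subspace_eq_self
        (⟨z, hmem z⟩ : ↥(((⊥ : Submodule ℝ F).comap W.subtype)ᗮ))
    have h3 : v i = ⟨z, hmem z⟩ := by rw [← this]; exact hz'.symm
    rw [h3]
    exact hz
  have h3 := Hmin_pow_le hM.1 h1 h2
  rw [Fintype.card_fin] at h3
  exact h3

end mainsec
/-- If `(F, M)` has a chain of rational subspaces whose successive quotients
`Qᵢ` satisfy tensor multiplicativity with `(E, L)` and have nondecreasing minimal heights, then
`H_min((E, L) ⊗ (F, M)) = H_min(E, L) · H_min(F, M)`. -/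
theorem statement2 {E F : Type*} [NormedAddCommGroup E] [InnerProductSpace ℝ E]
    [FiniteDimensional ℝ E] [NormedAddCommGroup F] [InnerProductSpace ℝ F]
    [FiniteDimensional ℝ F] (L : Submodule ℤ E) (M : Submodule ℤ F)
    (hL : IsLat L) (hM : IsLat M)
    {t : ℕ} (C : Fin (t + 1) → Submodule ℝ F)
    (h0 : C 0 = ⊥) (hlast : C (Fin.last t) = ⊤)
    (hchain : ∀ i : Fin t, C i.castSucc < C i.succ)
    (hrat : ∀ i, IsRational M (C i))
    (hmult : ∀ i : Fin t, ∀ (G : Type*) [NormedAddCommGroup G] [InnerProductSpace ℝ G]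
      (tp : E →ₗ[ℝ] (↥(((C i.castSucc).comap (C i.succ).subtype)ᗮ)) →ₗ[ℝ] G),
      IsTensor tp →
        Hmin (tensorLat tp L (succQuot M (C i.castSucc) (C i.succ))) =
          Hmin L * Hmin (succQuot M (C i.castSucc) (C i.succ)))
    (hmono : ∀ i j : Fin t, (i : ℕ) + 1 = (j : ℕ) →
      Hmin (succQuot M (C i.castSucc) (C i.succ)) ≤
        Hmin (succQuot M (C j.castSucc) (C j.succ))) :
    ∀ (G : Type*) [NormedAddCommGroup G] [InnerProductSpace ℝ G]
      (tp : E →ₗ[ℝ] F →ₗ[ℝ] G), IsTensor tp →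
      Hmin (tensorLat tp L M) = Hmin L * Hmin M := by
  intro G _ _ tp htp
  have hG := tensor_finite htp
  rcases subsingleton_or_nontrivial E with hE | hE
  · have : Subsingleton G := (tEquiv htp).symm.toEquiv.subsingleton
    rw [Hmin_subsingleton, Hmin_subsingleton L, zero_mul]
  rcases subsingleton_or_nontrivial F with hF | hF
  · have : Subsingleton G := (tEquiv htp).symm.toEquiv.subsingleton
    rw [Hmin_subsingleton, Hmin_subsingleton M, mul_zero]
  apply le_antisymm (Hmin_tensor_le htp hL hM)
  have hlat := tensor_isLat htp hL hM
  have hGn : Nontrivial G := by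
    obtain ⟨a, ha⟩ := exists_ne (0 : E)
    obtain ⟨b, hb⟩ := exists_ne (0 : F)
    refine ⟨⟨tp a b, 0, ?_⟩⟩
    rw [← inner_self_ne_zero (𝕜 := ℝ), htp.2]
    exact mul_ne_zero (inner_self_ne_zero.2 ha) (inner_self_ne_zero.2 hb)
  have hQge : ∀ (k : ℕ) (hk : k < t),
      Hmin M ≤ Hmin (succQuot M (C (Fin.castSucc ⟨k, hk⟩)) (C (Fin.succ ⟨k, hk⟩))) := by
    intro k
    induction k with
    | zero =>
      intro hk
      have h1 : C (Fin.castSucc ⟨0, hk⟩) = ⊥ := h0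
      have h2 := hchain ⟨0, hk⟩
      have h3 := Hmin_first hM (hrat (Fin.succ ⟨0, hk⟩)) (bot_le.trans_lt h2).ne'
      rw [h1]
      exact h3
    | succ k ih =>
      intro hk
      exact (ih (by omega)).trans (hmono ⟨k, by omega⟩ ⟨k + 1, hk⟩ rfl)
  have main : ∀ (k : ℕ) (hk : k < t + 1) (n : ℕ) (v : Fin n → G), LinearIndependent ℝ v →
      (∀ i, v i ∈ tensorLat tp L (M ⊓ (C ⟨k, hk⟩).restrictScalars ℤ)) →
      (Hmin L * Hmin M) ^ (2 * n) ≤ gr v := by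
    intro k
    induction k with
    | zero =>
      intro hk n v hv hvM
      have h1 : C ⟨0, hk⟩ = ⊥ := h0
      rcases Nat.eq_zero_or_pos n with rfl | hn
      · simp [gr_empty]
      · exfalso
        apply hv.ne_zero ⟨0, hn⟩
        have h2 := hvM ⟨0, hn⟩
        obtain ⟨x, hx⟩ := hL.exists_basis
        obtain ⟨y, hy, hy'⟩ := tensorLat_expand _ hx h2
        rw [hy']
        refine Finset.sum_eq_zero fun i _ => ?_
        have h3 : y i ∈ C ⟨0, hk⟩ := (hy i).2
        rw [h1, Submodule.mem_bot] at h3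
        rw [h3, map_zero]
    | succ k ih =>
      intro hk
      have hkt : k < t := by omega
      obtain ⟨G', _, _, tp', htp'⟩ := exists_tensor (E := E)
        (F := ↥(((C (Fin.castSucc ⟨k, hkt⟩)).comap (C (Fin.succ ⟨k, hkt⟩)).subtype)ᗮ))
      refine step htp htp' (M₁ := M ⊓ (C (Fin.castSucc ⟨k, hkt⟩)).restrictScalars ℤ)
        (M₂ := M ⊓ (C (Fin.succ ⟨k, hkt⟩)).restrictScalars ℤ) hL
        (succQuot_isLat hM (hchain ⟨k, hkt⟩).le (hrat _) (hrat _))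
        (sqProj_norm_le (C (Fin.castSucc ⟨k, hkt⟩)) (C (Fin.succ ⟨k, hkt⟩)))
        (fun y hy => sqProj_mem M _ _ hy.1 hy.2)
        (fun y hy hy0 => ⟨hy.1, sqProj_ker _ _ hy.2 hy0⟩)
        (mul_nonneg (Hmin_nonneg L) (Hmin_nonneg M)) ?_ (ih (by omega))
      rw [hmult ⟨k, hkt⟩ G' tp' htp']
      exact mul_le_mul_of_nonneg_left (hQge k hkt) (Hmin_nonneg L)
  apply le_Hmin_of hlat
  intro n v hv hvM
  refine main t (Nat.lt_succ_self t) n v hv ?_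
  have h1 : C ⟨t, Nat.lt_succ_self t⟩ = ⊤ := hlast
  rw [h1]
  simpa using hvM

end EucLat
end
end

section
/- Let (E, L) be a Euclidean lattice with dual lattice L*. If 0 = E₀ ⊊ E₁ ⊊ ⋯ ⊊ E_ℓ = E is a GS-flag of (E, L), then 0 = (E_ℓ)^⊥ ⊊ (E_{ℓ−1})^⊥ ⊊ ⋯ ⊊ (E₁)^⊥ ⊊ (E₀)^⊥ = E is a GS-flag of (E, L*), where ⊥ denotes the orthogonal complement in E. -/
open Module

noncomputable section

namespace EucLat

variable {E : Type*} [NormedAddCommGroup E] [InnerProductSpace ℝ E]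

/-! ### Lattices with an explicit basis -/

/-- `L` is the `ℤ`-span of the real basis `b`. -/
def IsB {ι : Type*} (L : Submodule ℤ E) (b : Basis ι ℝ E) : Prop :=
  L = Submodule.span ℤ (Set.range b)

/-- `L` has a basis which is a real basis of the ambient space. -/
def HasB (L : Submodule ℤ E) : Prop := ∃ (n : ℕ) (b : Basis (Fin n) ℝ E), IsB L b

theorem IsB.hasB {ι : Type*} [Fintype ι] {L : Submodule ℤ E} {b : Basis ι ℝ E} (h : IsB L b) :
    HasB L := by
  refine ⟨Fintype.card ι, b.reindex (Fintype.equivFin ι), ?_⟩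
  unfold IsB at *
  rw [h, Basis.range_reindex]

theorem IsB.mem_iff {ι : Type*} {L : Submodule ℤ E} {b : Basis ι ℝ E} (h : IsB L b) (x : E) :
    x ∈ L ↔ ∀ i, ∃ n : ℤ, b.repr x i = n := by
  rw [h, Basis.mem_span_iff_repr_mem]
  simp [eq_comm]

theorem IsB.basis_mem {ι : Type*} {L : Submodule ℤ E} {b : Basis ι ℝ E} (h : IsB L b) (i : ι) :
    b i ∈ L := by
  rw [h]; exact Submodule.subset_span ⟨i, rfl⟩

theorem isB_of_mem_iff {ι : Type*} {L : Submodule ℤ E} {b : Basis ι ℝ E}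
    (h : ∀ x, x ∈ L ↔ ∀ i, ∃ n : ℤ, b.repr x i = n) : IsB L b := by
  unfold IsB
  ext x
  rw [h, Basis.mem_span_iff_repr_mem]
  simp [eq_comm]

theorem hasB_of_isLat [FiniteDimensional ℝ E] {L : Submodule ℤ E} (hL : IsLat L) : HasB L := by
  obtain ⟨h1, h2⟩ := hL
  have : IsZLattice ℝ L := ⟨h2⟩
  have : Module.Finite ℤ L := ZLattice.module_finite ℝ L
  have : Module.Free ℤ L := ZLattice.module_free ℝ L
  refine IsB.hasB (b := (Module.Free.chooseBasis ℤ L).ofZLatticeBasis ℝ L) ?_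
  exact (Basis.ofZLatticeBasis_span ℝ L _).symm

/-! ### Covolume -/

theorem gram_det_eq_of_zbasis {ι : Type*} [Fintype ι] [DecidableEq ι] {L : Submodule ℤ E}
    (e f : Basis ι ℤ L) :
    (Matrix.gram ℝ fun i => (e i : E)).det = (Matrix.gram ℝ fun i => (f i : E)).det := by
  set P : Matrix ι ι ℤ := e.toMatrix f with hP
  have hf : ∀ j, (f j : E) = ∑ i, (P i j : ℝ) • (e i : E) := by
    intro j
    have := e.sum_toMatrix_smul_self f j
    rw [← this]
    push_cast
    refine Finset.sum_congr rfl fun i _ => ?_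
    rw [Int.cast_smul_eq_zsmul]
  have hG : Matrix.gram ℝ (fun i => (f i : E)) =
      (P.map (Int.cast : ℤ → ℝ)).transpose * Matrix.gram ℝ (fun i => (e i : E)) *
        P.map (Int.cast : ℤ → ℝ) := by
    ext i j
    simp only [Matrix.gram_apply, Matrix.mul_apply, Matrix.transpose_apply, Matrix.map_apply]
    rw [hf i, hf j]
    simp only [sum_inner, inner_sum, real_inner_smul_left, real_inner_smul_right,
      Finset.sum_mul]
    refine Finset.sum_congr rfl fun a _ => Finset.sum_congr rfl fun c _ => ?_
    ring
  have hu : IsUnit P.det := by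
    have : P * f.toMatrix e = 1 := by rw [hP, Basis.toMatrix_mul_toMatrix_flip]
    have h2 := congrArg Matrix.det this
    rw [Matrix.det_mul, Matrix.det_one] at h2
    exact IsUnit.of_mul_eq_one _ h2
  have hd : (P.map (Int.cast : ℤ → ℝ)).det = (P.det : ℝ) :=
    (RingHom.map_det (Int.castRingHom ℝ) P).symm
  rw [hG, Matrix.det_mul, Matrix.det_mul, Matrix.det_transpose, hd]
  rcases Int.isUnit_iff.1 hu with h | h <;> rw [h] <;> simp

theorem IsB.covol_eq {ι : Type*} [Fintype ι] [DecidableEq ι] {L : Submodule ℤ E}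
    {b : Basis ι ℝ E} (h : IsB L b) : covol L = √ (Matrix.gram ℝ b).det := by
  unfold IsB at h
  subst h
  have hex : ∃ n : ℕ, Nonempty (Basis (Fin n) ℤ (Submodule.span ℤ (Set.range b))) :=
    ⟨Fintype.card ι, ⟨(b.restrictScalars ℤ).reindex (Fintype.equivFin ι)⟩⟩
  unfold covol
  rw [dif_pos hex]
  congr 1
  set e := hex.choose_spec.some with he
  let σ := (b.restrictScalars ℤ).indexEquiv e
  have h1 := gram_det_eq_of_zbasis e ((b.restrictScalars ℤ).reindex σ)
  refine Eq.trans h1 ?_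
  rw [← Matrix.det_submatrix_equiv_self σ.symm (Matrix.gram ℝ b)]
  congr 1
  ext i j
  simp [Matrix.gram_apply]

theorem IsB.det_pos {ι : Type*} [Fintype ι] [DecidableEq ι]
    (b : Basis ι ℝ E) : 0 < (Matrix.gram ℝ b).det :=
  (Matrix.posDef_gram_of_linearIndependent b.linearIndependent).det_pos

theorem HasB.covol_pos {L : Submodule ℤ E} (h : HasB L) : 0 < covol L := by
  obtain ⟨n, b, hb⟩ := h
  rw [hb.covol_eq]
  exact Real.sqrt_pos.2 (IsB.det_pos b)

/-! ### Dual bases -/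

theorem exists_dual {ι : Type*} [Fintype ι] [DecidableEq ι] (b : Basis ι ℝ E) :
    ∃ d : Basis ι ℝ E, ∀ i j, (inner ℝ (b i) (d j) : ℝ) = if i = j then 1 else 0 := by
  have hN : LinearMap.BilinForm.Nondegenerate (innerₗ E) := by
    constructor
    · intro x hx
      exact inner_self_eq_zero.1 (hx x)
    · intro x hx
      exact inner_self_eq_zero.1 (hx x)
  have : FiniteDimensional ℝ E := b.finiteDimensional_of_finite
  refine ⟨LinearMap.BilinForm.dualBasis (innerₗ E) hN b, fun i j => ?_⟩
  have := LinearMap.BilinForm.apply_dualBasis_left (B := innerₗ E) hN b j i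
  rw [real_inner_comm]
  exact this

/-- `d` is dual to `b`. -/
def IsDB {ι : Type*} [DecidableEq ι] (b d : Basis ι ℝ E) : Prop :=
  ∀ i j, (inner ℝ (b i) (d j) : ℝ) = if i = j then 1 else 0

theorem IsDB.symm {ι : Type*} [DecidableEq ι] {b d : Basis ι ℝ E} (h : IsDB b d) : IsDB d b := by
  intro i j
  rw [real_inner_comm, h j i]
  simp [eq_comm]

theorem IsDB.repr_eq {ι : Type*} [Fintype ι] [DecidableEq ι] {b d : Basis ι ℝ E} (h : IsDB b d)
    (y : E) (i : ι) : d.repr y i = inner ℝ (b i) y := by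
  conv_rhs => rw [← d.sum_repr y]
  simp only [inner_sum, real_inner_smul_right, h i]
  simp

theorem IsB.mem_dual {ι : Type*} {L : Submodule ℤ E} {b : Basis ι ℝ E}
    (hb : IsB L b) (y : E) :
    y ∈ dualLat L ↔ ∀ i, ∃ n : ℤ, (inner ℝ (b i) y : ℝ) = n := by
  constructor
  · intro hy i
    exact hy _ (hb.basis_mem i)
  · intro hy x hx
    rw [hb] at hx
    induction hx using Submodule.span_induction with
    | mem x hx => obtain ⟨i, rfl⟩ := hx; exact hy i
    | zero => exact ⟨0, by simp⟩
    | add x z _ _ h1 h2 =>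
      obtain ⟨m, hm⟩ := h1
      obtain ⟨n, hn⟩ := h2
      exact ⟨m + n, by rw [inner_add_left, hm, hn]; push_cast; ring⟩
    | smul a x _ h1 =>
      obtain ⟨m, hm⟩ := h1
      exact ⟨a * m, by
        rw [← Int.cast_smul_eq_zsmul ℝ, real_inner_smul_left, hm]; push_cast; ring⟩

theorem IsB.dual {ι : Type*} [Fintype ι] [DecidableEq ι] {L : Submodule ℤ E} {b d : Basis ι ℝ E}
    (hb : IsB L b) (h : IsDB b d) : IsB (dualLat L) d := by
  apply isB_of_mem_iff
  intro x
  rw [hb.mem_dual]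
  simp only [h.repr_eq]

theorem HasB.dual {L : Submodule ℤ E} (h : HasB L) : HasB (dualLat L) := by
  obtain ⟨n, b, hb⟩ := h
  obtain ⟨d, hd⟩ := exists_dual b
  exact ⟨n, d, hb.dual hd⟩

theorem HasB.dual_dual {L : Submodule ℤ E} (h : HasB L) : dualLat (dualLat L) = L := by
  obtain ⟨n, b, hb⟩ := h
  obtain ⟨d, hd⟩ := exists_dual b
  rw [((hb.dual hd).dual (IsDB.symm hd) : _ = _), (hb : _ = _)]

theorem IsDB.gram_mul {ι : Type*} [Fintype ι] [DecidableEq ι] {b d : Basis ι ℝ E}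
    (h : IsDB b d) : Matrix.gram ℝ d * Matrix.gram ℝ b = 1 := by
  ext i j
  simp only [Matrix.mul_apply, Matrix.gram_apply]
  rw [Matrix.one_apply, ← IsDB.symm h i j]
  conv_rhs => rw [← d.sum_repr (b j)]
  simp only [inner_sum, real_inner_smul_right, h.repr_eq]
  exact Finset.sum_congr rfl fun k _ => mul_comm _ _

theorem HasB.covol_dual {L : Submodule ℤ E} (h : HasB L) : covol (dualLat L) * covol L = 1 := by
  obtain ⟨n, b, hb⟩ := h
  obtain ⟨d, hd⟩ := exists_dual b
  rw [hb.covol_eq, (hb.dual hd).covol_eq, ← Real.sqrt_mul (IsB.det_pos d).le, ← Matrix.det_mul,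
    IsDB.gram_mul hd]
  simp

/-! ### Adapted bases -/

/-- `b` is a basis of `L` whose first part spans `F`. -/
def IsAd {ι κ : Type*} (L : Submodule ℤ E) (F : Submodule ℝ E) (b : Basis (ι ⊕ κ) ℝ E) : Prop :=
  IsB L b ∧ F = Submodule.span ℝ (Set.range (b ∘ Sum.inl))

theorem exists_adapted {L : Submodule ℤ E} (hL : HasB L) {F : Submodule ℝ E}
    (hF : IsRational L F) : ∃ (k m : ℕ) (b : Basis (Fin k ⊕ Fin m) ℝ E), IsAd L F b := by
  obtain ⟨n, b, hb⟩ := hL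
  have hb' : L = Submodule.span ℤ (Set.range b) := hb
  have bZ : Basis (Fin n) ℤ L := by rw [hb']; exact b.restrictScalars ℤ
  have : Module.Free ℤ L := .of_basis bZ
  have : Module.Finite ℤ L := .of_basis bZ
  let N : Submodule ℤ L := (F.restrictScalars ℤ).comap L.subtype
  have hmemN : ∀ x : L, x ∈ N ↔ (x : E) ∈ F := fun x => Iff.rfl
  have : IsTorsionFree ℤ (L ⧸ N) := by
    rw [Module.isTorsionFree_iff_smul_eq_zero]
    intro r x h
    obtain ⟨x, rfl⟩ := N.mkQ_surjective x
    by_cases hr : r = 0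
    · exact Or.inl hr
    · right
      rw [← map_smul] at h
      simp only [Submodule.mkQ_apply, Submodule.Quotient.mk_eq_zero, hmemN] at h ⊢
      have h' : (r : ℝ) • (x : E) ∈ F := by rw [Int.cast_smul_eq_zsmul]; exact_mod_cast h
      exact (Submodule.smul_mem_iff _ (by exact_mod_cast hr)).1 h'
  have : Module.Free ℤ (L ⧸ N) := Module.free_of_finite_type_torsion_free'
  let bN := Module.finBasis ℤ N
  let bQ := Module.finBasis ℤ (L ⧸ N)
  let e := bN.sumQuot bQ
  have hspL : L = Submodule.span ℤ (Set.range fun i => (e i : E)) := by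
    have h1 : Set.range (fun i => (e i : E)) = L.subtype '' Set.range e := by
      rw [← Set.range_comp]; rfl
    rw [h1, ← Submodule.map_span, e.span_eq, Submodule.map_top, Submodule.range_subtype]
  have hspE : ⊤ ≤ Submodule.span ℝ (Set.range fun i => (e i : E)) := by
    rw [← b.span_eq, Submodule.span_le]
    rintro _ ⟨i, rfl⟩
    have h1 := hb.basis_mem i
    rw [hspL] at h1
    exact Submodule.span_subset_span ℤ ℝ _ h1
  have hcard : Fintype.card (Fin (finrank ℤ N) ⊕ Fin (finrank ℤ (L ⧸ N))) = finrank ℝ E := by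
    rw [Module.finrank_eq_card_basis b, ← Module.finrank_eq_card_basis bZ,
      Module.finrank_eq_card_basis e]
  refine ⟨_, _, basisOfTopLeSpanOfCardEqFinrank _ hspE hcard, ?_, ?_⟩
  · unfold IsB
    rw [coe_basisOfTopLeSpanOfCardEqFinrank]
    exact hspL
  · rw [coe_basisOfTopLeSpanOfCardEqFinrank]
    apply le_antisymm
    · conv_lhs => rw [← hF]
      rw [Submodule.span_le]
      rintro x ⟨hxL, hxF⟩
      have h2 : (⟨⟨x, hxL⟩, hxF⟩ : N) ∈ Submodule.span ℤ (Set.range bN) := by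
        rw [bN.span_eq]; trivial
      have h3 := Submodule.mem_map_of_mem (f := L.subtype ∘ₗ N.subtype) h2
      rw [Submodule.map_span, ← Set.range_comp] at h3
      refine Submodule.span_subset_span ℤ ℝ _ ?_
      have h4 : (fun i => (e i : E)) ∘ Sum.inl = (L.subtype ∘ₗ N.subtype) ∘ bN := by
        ext i
        simp [e]
      rw [h4]
      exact h3
    · rw [Submodule.span_le]
      rintro _ ⟨i, rfl⟩
      have : (bN i : L) ∈ N := (bN i).2
      simpa [e] using (hmemN _).1 this

theorem IsAd.basis_mem {ι κ : Type*} {L : Submodule ℤ E} {F : Submodule ℝ E}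
    {b : Basis (ι ⊕ κ) ℝ E} (h : IsAd L F b) (i : ι) : b (Sum.inl i) ∈ F := by
  rw [h.2]; exact Submodule.subset_span ⟨i, rfl⟩

/-- The basis of `F` induced by an adapted basis. -/
theorem IsAd.exists_sub {ι κ : Type*} [Fintype ι] {L : Submodule ℤ E} {F : Submodule ℝ E}
    {b : Basis (ι ⊕ κ) ℝ E} (h : IsAd L F b) :
    ∃ c : Basis ι ℝ F, (∀ i, (c i : E) = b (Sum.inl i)) ∧ IsB (latIn L F) c := by
  have hli : LinearIndependent ℝ (b ∘ Sum.inl) :=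
    b.linearIndependent.comp _ Sum.inl_injective
  let c : Basis ι ℝ F := (Basis.span hli).map (LinearEquiv.ofEq _ _ h.2.symm)
  have hc : ∀ i, (c i : E) = b (Sum.inl i) := by
    intro i
    simp [c, Basis.span_apply]
  refine ⟨c, hc, isB_of_mem_iff fun x => ?_⟩
  have hx : (x : E) = ∑ i, c.repr x i • b (Sum.inl i) := by
    have h1 := congrArg Subtype.val (c.sum_repr x)
    rw [← h1]
    simp only [AddSubmonoidClass.coe_finsetSum, Submodule.coe_smul, hc]
  have hmem : x ∈ latIn L F ↔ (x : E) ∈ L := Iff.rfl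
  rw [hmem, h.1.mem_iff]
  have hl : ∀ i, b.repr (x : E) (Sum.inl i) = c.repr x i := by
    intro i
    classical
    rw [hx]
    simp [Finsupp.single_apply, Sum.inl_injective.eq_iff]
  have hr : ∀ j, b.repr (x : E) (Sum.inr j) = 0 := by
    intro j
    rw [hx]
    simp
  constructor
  · intro H i
    rw [← hl]; exact H _
  · rintro H (i | j)
    · rw [hl]; exact H i
    · exact ⟨0, by rw [hr]; simp⟩

theorem IsAd.isRational {ι κ : Type*} {L : Submodule ℤ E} {F : Submodule ℝ E}
    {b : Basis (ι ⊕ κ) ℝ E} (h : IsAd L F b) : IsRational L F := by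
  unfold IsRational
  apply le_antisymm
  · rw [Submodule.span_le]
    exact fun x hx => hx.2
  · conv_lhs => rw [h.2]
    apply Submodule.span_mono
    rintro _ ⟨i, rfl⟩
    exact ⟨h.1.basis_mem _, h.basis_mem i⟩

theorem HasB.latIn {L : Submodule ℤ E} (hL : HasB L) {F : Submodule ℝ E}
    (hF : IsRational L F) : HasB (latIn L F) := by
  obtain ⟨k, m, b, hb⟩ := exists_adapted hL hF
  obtain ⟨c, -, hc⟩ := hb.exists_sub
  exact hc.hasB

theorem IsAd.mem_orth {ι κ : Type*} {L : Submodule ℤ E} {F : Submodule ℝ E}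
    {b : Basis (ι ⊕ κ) ℝ E} (h : IsAd L F b) (y : E) :
    y ∈ Fᗮ ↔ ∀ i, (inner ℝ (b (Sum.inl i)) y : ℝ) = 0 := by
  constructor
  · intro hy i
    exact hy _ (h.basis_mem i)
  · intro hy x hx
    rw [h.2] at hx
    induction hx using Submodule.span_induction with
    | mem x hx => obtain ⟨i, rfl⟩ := hx; exact hy i
    | zero => simp
    | add x z _ _ h1 h2 => rw [inner_add_left, h1, h2, add_zero]
    | smul a x _ h1 => rw [real_inner_smul_left, h1, mul_zero]

theorem IsAd.dual {ι κ : Type*} [Fintype ι] [DecidableEq ι] [Fintype κ] [DecidableEq κ]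
    {L : Submodule ℤ E} {F : Submodule ℝ E}
    {b d : Basis (ι ⊕ κ) ℝ E} (h : IsAd L F b) (hd : IsDB b d) :
    IsAd (dualLat L) Fᗮ (d.reindex (Equiv.sumComm ι κ)) := by
  constructor
  · have := h.1.dual hd
    unfold IsB at *
    rw [this, Basis.range_reindex]
  · apply le_antisymm
    · intro y hy
      rw [h.mem_orth] at hy
      rw [← d.sum_repr y, Fintype.sum_sum_type]
      refine add_mem (sum_mem fun i _ => ?_) (sum_mem fun j _ => ?_)
      · rw [hd.repr_eq, hy i, zero_smul]; exact zero_mem _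
      · refine Submodule.smul_mem _ _ (Submodule.subset_span ⟨j, by simp⟩)
    · rw [Submodule.span_le]
      rintro _ ⟨j, rfl⟩
      rw [SetLike.mem_coe, h.mem_orth]
      intro i
      simp [hd _ _]

theorem IsRational.dual {L : Submodule ℤ E} (hL : HasB L) {F : Submodule ℝ E}
    (hF : IsRational L F) : IsRational (dualLat L) Fᗮ := by
  obtain ⟨k, m, b, hb⟩ := exists_adapted hL hF
  obtain ⟨d, hd⟩ := exists_dual b
  exact (hb.dual hd).isRational

/-- Extension of integral functionals. -/
theorem exists_ext {L : Submodule ℤ E} (hL : HasB L) {F : Submodule ℝ E}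
    (hF : IsRational L F) (z : E) (hz : ∀ x ∈ L, x ∈ F → ∃ n : ℤ, (inner ℝ x z : ℝ) = n) :
    ∃ y ∈ dualLat L, ∀ x ∈ F, (inner ℝ x y : ℝ) = inner ℝ x z := by
  obtain ⟨k, m, b, hb⟩ := exists_adapted hL hF
  obtain ⟨d, hd⟩ := exists_dual b
  let y : E := ∑ i, (inner ℝ (b (Sum.inl i)) z : ℝ) • d (Sum.inl i)
  have hl : ∀ i, (inner ℝ (b (Sum.inl i)) y : ℝ) = inner ℝ (b (Sum.inl i)) z := by
    intro i
    simp [y, inner_sum, real_inner_smul_right, hd _ _]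
  have hr : ∀ j, (inner ℝ (b (Sum.inr j)) y : ℝ) = 0 := by
    intro j
    simp [y, inner_sum, real_inner_smul_right, hd _ _]
  refine ⟨y, (hb.1.mem_dual y).2 ?_, ?_⟩
  · rintro (i | j)
    · rw [hl]; exact hz _ (hb.1.basis_mem _) (hb.basis_mem i)
    · exact ⟨0, by rw [hr]; simp⟩
  · have : y - z ∈ Fᗮ := by
      rw [hb.mem_orth]
      intro i
      rw [inner_sub_right, hl, sub_self]
    intro x hx
    have h2 := this x hx
    rwa [inner_sub_right, sub_eq_zero] at h2

theorem covol_dual_orth {L : Submodule ℤ E} (hL : HasB L) {F : Submodule ℝ E}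
    (hF : IsRational L F) :
    covol (latIn (dualLat L) Fᗮ) * covol L = covol (latIn L F) := by
  obtain ⟨k, m, b, hb⟩ := exists_adapted hL hF
  obtain ⟨d, hd⟩ := exists_dual b
  have hd' : IsDB b d := hd
  obtain ⟨c, hc, hcB⟩ := hb.exists_sub
  obtain ⟨c', hc', hcB'⟩ := (hb.dual hd).exists_sub
  rw [hcB.covol_eq, hcB'.covol_eq, hb.1.covol_eq, ← Real.sqrt_mul (IsB.det_pos c').le]
  congr 1
  have key : Matrix.fromBlocks 1 0
      (Matrix.of fun i j => (inner ℝ (d (Sum.inr i)) (d (Sum.inl j)) : ℝ)) (Matrix.gram ℝ c') *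
      Matrix.gram ℝ b = Matrix.fromBlocks (Matrix.gram ℝ c)
      (Matrix.of fun i j => (inner ℝ (b (Sum.inl i)) (b (Sum.inr j)) : ℝ)) 0 1 := by
    have hg := hd'.gram_mul
    ext (i | i) (j | j)
    · simp [Matrix.mul_apply, Matrix.one_apply, Matrix.gram_apply, hc]
    · simp [Matrix.mul_apply, Matrix.one_apply, Matrix.gram_apply]
    · have := congrFun (congrFun hg (Sum.inr i)) (Sum.inl j)
      simpa [Matrix.mul_apply, Matrix.gram_apply, hc'] using this
    · have := congrFun (congrFun hg (Sum.inr i)) (Sum.inr j)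
      simpa [Matrix.mul_apply, Matrix.gram_apply, hc', Matrix.one_apply] using this
  have h2 := congrArg Matrix.det key
  rw [Matrix.det_mul, Matrix.det_fromBlocks_zero₁₂, Matrix.det_fromBlocks_zero₂₁] at h2
  simpa using h2

/-! ### Semistability of the dual -/

theorem HasB.redH_pos {L : Submodule ℤ E} (h : HasB L) : 0 < redH L :=
  Real.rpow_pos_of_pos h.covol_pos _

theorem HasB.redH_dual {L : Submodule ℤ E} (h : HasB L) : redH (dualLat L) = (redH L)⁻¹ := by
  unfold redH
  rw [eq_inv_of_mul_eq_one_left h.covol_dual, Real.inv_rpow h.covol_pos.le]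

theorem Semistable.dual [FiniteDimensional ℝ E] {L : Submodule ℤ E} (hL : HasB L)
    (hs : Semistable L) : Semistable (dualLat L) := by
  intro G hG hrG
  have hF : IsRational L Gᗮ := by
    have := IsRational.dual hL.dual hrG
    rwa [hL.dual_dual] at this
  have hcov := covol_dual_orth hL hF
  rw [Submodule.orthogonal_orthogonal] at hcov
  have hpos := hL.covol_pos
  have hposG : 0 < covol (latIn (dualLat L) G) := (hL.dual.latIn hrG).covol_pos
  have hposF : 0 < covol (latIn L Gᗮ) := (hL.latIn hF).covol_pos
  have hdim : finrank ℝ G + finrank ℝ Gᗮ = finrank ℝ E := G.finrank_add_finrank_orthogonal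
  have hG0 : 0 < finrank ℝ G := by
    rw [Nat.pos_iff_ne_zero]
    intro h
    exact hG (Submodule.finrank_eq_zero.1 h)
  have hdim' : (finrank ℝ G : ℝ) + finrank ℝ Gᗮ = finrank ℝ E := by exact_mod_cast hdim
  have hG0' : (0 : ℝ) < finrank ℝ G := by exact_mod_cast hG0
  -- logarithmic form of semistability
  have hlog : (finrank ℝ Gᗮ : ℝ) * Real.log (covol L) ≤
      (finrank ℝ E : ℝ) * Real.log (covol (latIn L Gᗮ)) := by
    by_cases hb : Gᗮ = ⊥
    · have hGt : G = ⊤ := by rwa [Submodule.orthogonal_eq_bot_iff] at hb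
      have h1 : covol (latIn L Gᗮ) = 1 := by
        have hz : finrank ℝ Gᗮ = 0 := by rw [hb]; simp
        obtain ⟨n, c, hc⟩ := hL.latIn hF
        rw [Module.finrank_eq_card_basis c, Fintype.card_fin] at hz
        subst hz
        rw [hc.covol_eq]
        simp
      rw [h1, Real.log_one, mul_zero, hb]
      simp
    · have h1 := hs _ hb hF
      have hF0 : 0 < finrank ℝ Gᗮ := by
        rw [Nat.pos_iff_ne_zero]
        intro h
        exact hb (Submodule.finrank_eq_zero.1 h)
      have hF0' : (0 : ℝ) < finrank ℝ Gᗮ := by exact_mod_cast hF0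
      have hE0' : (0 : ℝ) < finrank ℝ E := by linarith
      unfold Hr redH at h1
      have h2 := Real.log_le_log (Real.rpow_pos_of_pos hpos _) h1
      rw [Real.log_rpow hpos, Real.log_rpow hposF] at h2
      rw [inv_mul_le_iff₀ hE0', mul_left_comm, le_inv_mul_iff₀ hF0'] at h2
      exact h2
  have hE0' : (0 : ℝ) < finrank ℝ E := by
    have : (0 : ℝ) ≤ finrank ℝ Gᗮ := Nat.cast_nonneg _
    linarith
  rw [hL.redH_dual]
  unfold Hr redH
  rw [← Real.log_le_log_iff (inv_pos.2 (Real.rpow_pos_of_pos hpos _))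
    (Real.rpow_pos_of_pos hposG _), Real.log_inv, Real.log_rpow hpos, Real.log_rpow hposG]
  have hc2 : Real.log (covol (latIn L Gᗮ)) =
      Real.log (covol (latIn (dualLat L) G)) + Real.log (covol L) := by
    rw [← hcov, Real.log_mul hposG.ne' hpos.ne']
  rw [hc2] at hlog
  rw [le_inv_mul_iff₀ hG0']
  have : (finrank ℝ G : ℝ) * -((finrank ℝ E : ℝ)⁻¹ * Real.log (covol L)) =
      (finrank ℝ E : ℝ)⁻¹ * (-(finrank ℝ G : ℝ) * Real.log (covol L)) := by ring
  rw [this, inv_mul_le_iff₀ hE0']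
  rw [← hdim'] at hlog ⊢
  linarith

/-! ### Invariance under isometries -/

section iso

variable {E' : Type*} [NormedAddCommGroup E'] [InnerProductSpace ℝ E']

theorem covol_iso {L : Submodule ℤ E} (hL : HasB L) {L' : Submodule ℤ E'}
    (φ : E ≃ₗᵢ[ℝ] E') (h : ∀ x, x ∈ L ↔ φ x ∈ L') : covol L' = covol L := by
  obtain ⟨n, b, hb⟩ := hL
  have hb' : IsB L' (b.map φ.toLinearEquiv) := by
    apply isB_of_mem_iff
    intro x
    obtain ⟨x, rfl⟩ := φ.surjective x
    rw [← h, hb.mem_iff]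
    simp
  rw [hb.covol_eq, hb'.covol_eq]
  congr 2
  ext i j
  simp [Matrix.gram_apply]

theorem redH_iso {L : Submodule ℤ E} (hL : HasB L) {L' : Submodule ℤ E'}
    (φ : E ≃ₗᵢ[ℝ] E') (h : ∀ x, x ∈ L ↔ φ x ∈ L') : redH L' = redH L := by
  unfold redH
  rw [covol_iso hL φ h, φ.toLinearEquiv.finrank_eq]

theorem Semistable.iso {L : Submodule ℤ E} (hL : HasB L) {L' : Submodule ℤ E'}
    (φ : E ≃ₗᵢ[ℝ] E') (h : ∀ x, x ∈ L ↔ φ x ∈ L') (hs : Semistable L) : Semistable L' := by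
  intro F' hF' hr
  obtain ⟨F, rfl⟩ : ∃ F : Submodule ℝ E, F' = F.map (φ.toLinearEquiv : E →ₗ[ℝ] E') :=
    ⟨F'.comap (φ.toLinearEquiv : E →ₗ[ℝ] E'), by
      rw [Submodule.map_comap_eq_of_surjective]; exact φ.surjective⟩
  have hr' : IsRational L F := by
    unfold IsRational at hr ⊢
    apply Submodule.map_injective_of_injective (f := (φ.toLinearEquiv : E →ₗ[ℝ] E')) φ.injective
    rw [Submodule.map_span]
    conv_rhs => rw [← hr]
    congr 1
    ext y
    obtain ⟨x, rfl⟩ := φ.surjective y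
    constructor
    · rintro ⟨z, ⟨hz1, hz2⟩, hz⟩
      obtain rfl : z = x := φ.injective hz
      exact ⟨(h z).1 hz1, ⟨z, hz2, rfl⟩⟩
    · rintro ⟨h1, z, hz, hzx⟩
      obtain rfl : z = x := φ.injective hzx
      exact ⟨z, ⟨(h z).2 h1, hz⟩, rfl⟩
  have hne : F ≠ ⊥ := by
    rintro rfl
    exact hF' (Submodule.map_bot _)
  rw [redH_iso hL φ h]
  refine (hs F hne hr').trans (le_of_eq ?_)
  unfold Hr
  refine (redH_iso (hL.latIn hr') (φ.submoduleMap F) ?_).symm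
  intro x
  exact h x

end iso

/-! ### Successive quotients -/

section quot

variable [FiniteDimensional ℝ E]

theorem IsRational.comap {L : Submodule ℤ E} {F F' : Submodule ℝ E}
    (hF : IsRational L F) (hle : F ≤ F') : IsRational (latIn L F') (F.comap F'.subtype) := by
  unfold IsRational at *
  apply Submodule.map_injective_of_injective (f := F'.subtype) F'.injective_subtype
  rw [Submodule.map_span, Submodule.map_comap_subtype, inf_eq_right.2 hle]
  conv_rhs => rw [← hF]
  congr 1
  ext x
  constructor
  · rintro ⟨z, ⟨h1, h2⟩, rfl⟩
    exact ⟨h1, h2⟩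
  · rintro ⟨h1, h2⟩
    exact ⟨⟨x, hle h2⟩, ⟨h1, h2⟩, rfl⟩

/-- The quotient lattice is the dual of the orthogonal sublattice of the dual. -/
theorem quotLat_eq {L : Submodule ℤ E} (hL : HasB L) {F : Submodule ℝ E}
    (hF : IsRational L F) : quotLat L F = dualLat (latIn (dualLat L) Fᗮ) := by
  ext z
  constructor
  · rintro ⟨x, hx, rfl⟩ y hy
    obtain ⟨n, hn⟩ := hy x hx
    refine ⟨n, ?_⟩
    rw [← hn]
    have := Submodule.inner_orthogonalProjectionOnto_eq_of_mem_left (𝕜 := ℝ) (K := Fᗮ) y x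
    refine Eq.trans this ?_
    exact real_inner_comm _ _
  · intro hz
    obtain ⟨y, hy, hy2⟩ := exists_ext hL.dual (IsRational.dual hL hF) (z : E)
      (fun x hx hxF => hz ⟨x, hxF⟩ hx)
    rw [hL.dual_dual] at hy
    refine ⟨y, hy, ?_⟩
    apply ext_inner_left ℝ
    intro v
    have := Submodule.inner_orthogonalProjectionOnto_eq_of_mem_left (𝕜 := ℝ) (K := Fᗮ) v y
    refine Eq.trans this ?_
    exact hy2 v v.2

theorem HasB.quotLat {L : Submodule ℤ E} (hL : HasB L) {F : Submodule ℝ E}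
    (hF : IsRational L F) : HasB (quotLat L F) := by
  rw [quotLat_eq hL hF]
  exact (hL.dual.latIn (IsRational.dual hL hF)).dual

theorem HasB.succQuot {L : Submodule ℤ E} (hL : HasB L) {F F' : Submodule ℝ E}
    (hF : IsRational L F) (hF' : IsRational L F') (hle : F ≤ F') : HasB (succQuot L F F') :=
  (hL.latIn hF').quotLat (hF.comap hle)

theorem mem_comap_orth {F F' : Submodule ℝ E} (hle : F ≤ F') (z : F') :
    z ∈ (F.comap F'.subtype)ᗮ ↔ (z : E) ∈ Fᗮ := by
  constructor
  · intro h x hx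
    exact h ⟨x, hle hx⟩ hx
  · intro h x hx
    exact h x hx

theorem mem_comap_orth' {F F' : Submodule ℝ E} (hle : F ≤ F') (z : (Fᗮ : Submodule ℝ E)) :
    z ∈ (F'ᗮ.comap Fᗮ.subtype)ᗮ ↔ (z : E) ∈ F' := by
  rw [mem_comap_orth (Submodule.orthogonal_le hle), Submodule.orthogonal_orthogonal]

/-- Both ambient spaces are copies of `F' ∩ Fᗮ`. -/
def quotIso {F F' : Submodule ℝ E} (hle : F ≤ F') :
    ((F.comap F'.subtype)ᗮ : Submodule ℝ F') ≃ₗᵢ[ℝ]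
      ((F'ᗮ.comap Fᗮ.subtype)ᗮ : Submodule ℝ (Fᗮ : Submodule ℝ E)) where
  toFun z := ⟨⟨z.1.1, (mem_comap_orth hle z.1).1 z.2⟩, (mem_comap_orth' hle _).2 z.1.2⟩
  invFun z := ⟨⟨z.1.1, (mem_comap_orth' hle z.1).1 z.2⟩, (mem_comap_orth hle _).2 z.1.2⟩
  map_add' _ _ := rfl
  map_smul' _ _ := rfl
  left_inv _ := rfl
  right_inv _ := rfl
  norm_map' _ := rfl

theorem mem_succQuot_dual {L : Submodule ℤ E} (hL : HasB L) {F F' : Submodule ℝ E}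
    (hF' : IsRational L F') (hle : F ≤ F')
    (z : ((F.comap F'.subtype)ᗮ : Submodule ℝ F')) :
    z ∈ dualLat (succQuot L F F') ↔ quotIso hle z ∈ succQuot (dualLat L) F'ᗮ Fᗮ := by
  constructor
  · intro hz
    obtain ⟨y, hy, hy2⟩ := exists_ext hL hF' (z.1.1 : E) (by
      intro x hx hxF
      obtain ⟨n, hn⟩ := hz _ ⟨⟨x, hxF⟩, hx, rfl⟩
      refine ⟨n, ?_⟩
      rw [← hn]
      exact (Submodule.inner_orthogonalProjectionOnto_eq_of_mem_right (𝕜 := ℝ)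
        (K := (F.comap F'.subtype)ᗮ) z ⟨x, hxF⟩).symm)
    have hyF : y ∈ Fᗮ := by
      intro x hx
      rw [hy2 x (hle hx)]
      exact (mem_comap_orth hle z.1).1 z.2 x hx
    refine ⟨⟨y, hyF⟩, hy, ?_⟩
    apply ext_inner_left ℝ
    intro v
    refine Eq.trans (Submodule.inner_orthogonalProjectionOnto_eq_of_mem_left (𝕜 := ℝ)
        (K := (F'ᗮ.comap Fᗮ.subtype)ᗮ) v ⟨y, hyF⟩) ?_
    exact hy2 v.1.1 ((mem_comap_orth' hle v.1).1 v.2)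
  · rintro ⟨y, hy, hyz⟩ w ⟨x, hx, rfl⟩
    obtain ⟨n, hn⟩ := hy x.1 hx
    refine ⟨n, ?_⟩
    rw [← hn]
    refine Eq.trans (Submodule.inner_orthogonalProjectionOnto_eq_of_mem_right (𝕜 := ℝ)
        (K := (F.comap F'.subtype)ᗮ) z x) ?_
    have h1 := Submodule.sub_starProjection_mem_orthogonal (𝕜 := ℝ)
      (K := (F'ᗮ.comap Fᗮ.subtype)ᗮ) y
    rw [Submodule.orthogonal_orthogonal, Submodule.starProjection_apply] at h1
    have hyz' : (Submodule.orthogonalProjectionOnto (F'ᗮ.comap Fᗮ.subtype)ᗮ) y =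
      quotIso hle z := hyz
    rw [hyz'] at h1
    have h2 : (inner ℝ (x : E) ((y : E) - (z.1.1 : E)) : ℝ) = 0 := h1 x.1 x.2
    rw [inner_sub_right, sub_eq_zero] at h2
    exact h2.symm

theorem Semistable.succQuot_dual {L : Submodule ℤ E} (hL : HasB L) {F F' : Submodule ℝ E}
    (hF : IsRational L F) (hF' : IsRational L F') (hle : F ≤ F')
    (hs : Semistable (succQuot L F F')) : Semistable (succQuot (dualLat L) F'ᗮ Fᗮ) :=
  have hB := hL.succQuot hF hF' hle
  (hs.dual hB).iso hB.dual (quotIso hle) (mem_succQuot_dual hL hF' hle)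

theorem redH_succQuot_dual {L : Submodule ℤ E} (hL : HasB L) {F F' : Submodule ℝ E}
    (hF : IsRational L F) (hF' : IsRational L F') (hle : F ≤ F') :
    redH (succQuot (dualLat L) F'ᗮ Fᗮ) = (redH (succQuot L F F'))⁻¹ := by
  have hB := hL.succQuot hF hF' hle
  rw [redH_iso hB.dual (quotIso hle) (mem_succQuot_dual hL hF' hle), hB.redH_dual]

end quot

/-- If `(Eᵢ)` is a GS-flag of `(E, L)` then `((E_{ℓ-i})ᗮ)` is a GS-flag of
`(E, L*)`. -/
theorem statement5 {E : Type*} [NormedAddCommGroup E] [InnerProductSpace ℝ E]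
    [FiniteDimensional ℝ E] (L : Submodule ℤ E) (hL : IsLat L)
    {ℓ : ℕ} (C : Fin (ℓ + 1) → Submodule ℝ E) (hC : IsGSFlag L C) :
    IsGSFlag (dualLat L) (fun i => (C i.rev)ᗮ) := by
  obtain ⟨h0, h1, hlt, hrat, hss, hred⟩ := hC
  have hB := hasB_of_isLat hL
  have hle : ∀ i : Fin ℓ, C i.castSucc ≤ C i.succ := fun i => (hlt i).le
  refine ⟨?_, ?_, ?_, ?_, ?_, ?_⟩
  · simp [h1]
  · simp [h0]
  · intro i
    change (C i.castSucc.rev)ᗮ < (C i.succ.rev)ᗮ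
    rw [Fin.rev_castSucc, Fin.rev_succ]
    refine lt_of_le_of_ne (Submodule.orthogonal_le (hle _)) fun h => (hlt i.rev).ne' ?_
    have h2 := congrArg (fun K : Submodule ℝ E => Kᗮ) h
    simpa only [Submodule.orthogonal_orthogonal] using h2
  · intro i
    exact IsRational.dual hB (hrat _)
  · intro i
    change Semistable (succQuot (dualLat L) (C i.castSucc.rev)ᗮ (C i.succ.rev)ᗮ)
    rw [Fin.rev_castSucc, Fin.rev_succ]
    exact Semistable.succQuot_dual hB (hrat _) (hrat _) (hle _) (hss _)
  · intro i j hij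
    have key : ∀ i : Fin ℓ, redH (succQuot (dualLat L) (C i.castSucc.rev)ᗮ (C i.succ.rev)ᗮ) =
        (redH (succQuot L (C i.rev.castSucc) (C i.rev.succ)))⁻¹ := by
      intro i
      rw [Fin.rev_castSucc, Fin.rev_succ]
      exact redH_succQuot_dual hB (hrat _) (hrat _) (hle _)
    change redH (succQuot (dualLat L) (C i.castSucc.rev)ᗮ (C i.succ.rev)ᗮ) <
      redH (succQuot (dualLat L) (C j.castSucc.rev)ᗮ (C j.succ.rev)ᗮ)
    rw [key i, key j]
    exact inv_strictAnti₀ (hB.succQuot (hrat _) (hrat _) (hle _)).redH_pos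
      (hred _ _ (Fin.rev_lt_rev.2 hij))

end EucLat
end
end
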